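/- arXiv:1701.00354 — 4 statements merged into one kernel-verified Lean document; each statement's English description precedes it below -/
import Mathlib

section
/- Let λ > 1, let n ≥ 1, and let A_n = (a_{ij}) be an n×n matrix with nonnegative entries such that every row sum equals n and a_{ij} ≤ λ for all i, j. Then perm(A_n) ≤ e^{2λ} · n^{(λ−1)/2} · n!. -/
noncomputable section

/-- The permanent of an `n × n` real matrix. -/
def permanent {n : ℕ} (M : Matrix (Fin n) (Fin n) ℝ) : ℝ :=
  ∑ π : Equiv.Perm (Fin n), ∏ i, M i (π i)

open Finset in
/-- For a nonnegative weight on a finite type and `m` at most its cardinality there is an `m`-set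
separated from its complement by a threshold. -/
theorem exists_card_eq_threshold {β : Type*} [Fintype β] [DecidableEq β] (c : β → ℝ)
    (hc : ∀ j, 0 ≤ c j) (m : ℕ) (hm : m ≤ Fintype.card β) :
    ∃ T : Finset β, T.card = m ∧ ∃ τ : ℝ, 0 ≤ τ ∧ (∀ j ∈ T, τ ≤ c j) ∧ ∀ j ∉ T, c j ≤ τ := by
  induction m with
  | zero =>
    exact ⟨∅, rfl, ∑ j, c j, sum_nonneg fun j _ => hc j, by simp,
      fun j _ => single_le_sum (fun i _ => hc i) (mem_univ j)⟩
  | succ m ih =>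
    obtain ⟨T, hT, τ, -, h1, h2⟩ := ih (by omega)
    have hne : Tᶜ.Nonempty := by
      rw [← card_pos, card_compl]
      omega
    obtain ⟨b, hb, hmax⟩ := exists_max_image Tᶜ c hne
    rw [mem_compl] at hb
    refine ⟨insert b T, by rw [card_insert_of_notMem hb, hT], c b, hc b, fun j hj => ?_,
      fun j hj => ?_⟩
    · rcases mem_insert.1 hj with rfl | hj
      · exact le_rfl
      · exact (h2 b hb).trans (h1 j hj)
    · exact hmax j (mem_compl.2 fun h => hj (mem_insert_of_mem h))

open Finset in
/-- A nonnegative linear functional on vectors with entries in `[0, L]` and sum at most `L * m` is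
bounded by its value at `L` times the indicator of some `m`-set. -/
theorem exists_card_eq_sum_mul_le {β : Type*} [Fintype β] [DecidableEq β] (c x : β → ℝ)
    (hc : ∀ j, 0 ≤ c j) (L : ℝ) (hx0 : ∀ j, 0 ≤ x j) (hxL : ∀ j, x j ≤ L) (m : ℕ)
    (hm : m ≤ Fintype.card β) (hsum : ∑ j, x j ≤ L * m) :
    ∃ T : Finset β, T.card = m ∧ ∑ j, x j * c j ≤ ∑ j, (if j ∈ T then L else 0) * c j := by
  obtain ⟨T, hT, τ, hτ, h1, h2⟩ := exists_card_eq_threshold c hc m hm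
  refine ⟨T, hT, ?_⟩
  have key : ∑ j, x j * (c j - τ) ≤ ∑ j, (if j ∈ T then L else 0) * (c j - τ) := by
    refine sum_le_sum fun j _ => ?_
    split_ifs with hj
    · exact mul_le_mul_of_nonneg_right (hxL j) (sub_nonneg.2 (h1 j hj))
    · rw [zero_mul]
      exact mul_nonpos_of_nonneg_of_nonpos (hx0 j) (sub_nonpos.2 (h2 j hj))
  have hind : ∑ j, (if j ∈ T then L else 0) = L * m := by
    simp [hT, mul_comm]
  simp only [mul_sub, sum_sub_distrib, ← sum_mul, hind] at key
  have := mul_le_mul_of_nonneg_right hsum hτ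
  linarith

open Finset in
/-- The permanent is linear in each row, with nonnegative coefficients if the matrix is
nonnegative. -/
theorem exists_permanent_updateRow_eq_sum {n : ℕ} (B : Matrix (Fin n) (Fin n) ℝ)
    (h0 : ∀ i j, 0 ≤ B i j) (i : Fin n) :
    ∃ c : Fin n → ℝ, (∀ j, 0 ≤ c j) ∧ ∀ x, permanent (B.updateRow i x) = ∑ j, x j * c j := by
  refine ⟨fun j => ∑ π : Equiv.Perm (Fin n) with π i = j, ∏ k ∈ univ.erase i, B k (π k),
    fun j => sum_nonneg fun π _ => prod_nonneg fun k _ => h0 _ _, fun x => ?_⟩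
  rw [permanent, ← sum_fiberwise univ (fun π : Equiv.Perm (Fin n) => π i)]
  refine sum_congr rfl fun j _ => ?_
  rw [mul_sum]
  refine sum_congr rfl fun π hπ => ?_
  rw [← mul_prod_erase univ _ (mem_univ i), Matrix.updateRow_self, (mem_filter.1 hπ).2]
  congr 1
  exact prod_congr rfl fun k hk => by rw [Matrix.updateRow_ne (ne_of_mem_erase hk)]

open Finset in
/-- A nonnegative matrix with entries at most `L` and row sums at most `L * m` has permanent at most
that of `L` times some 0-1 matrix with all row sums equal to `m`. -/
theorem exists_permanent_le_permanent_indicator {n m : ℕ} (hm : m ≤ n) {L : ℝ} (hL : 0 ≤ L)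
    (A : Matrix (Fin n) (Fin n) ℝ) (h0 : ∀ i j, 0 ≤ A i j) (hbd : ∀ i j, A i j ≤ L)
    (hrow : ∀ i, ∑ j, A i j ≤ L * m) :
    ∃ N : Fin n → Finset (Fin n), (∀ i, (N i).card = m) ∧
      permanent A ≤ permanent (fun i j => if j ∈ N i then L else 0) := by
  have main : ∀ s : Finset (Fin n), ∃ N : Fin n → Finset (Fin n), (∀ i ∈ s, (N i).card = m) ∧
      permanent A ≤
        permanent (fun i j => if i ∈ s then (if j ∈ N i then L else 0) else A i j) := by
    intro s
    induction s using Finset.induction_on with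
    | empty => exact ⟨fun _ => ∅, by simp, by simp⟩
    | insert i s his ih =>
      obtain ⟨N, hN, hle⟩ := ih
      set B : Matrix (Fin n) (Fin n) ℝ :=
        fun i j => if i ∈ s then (if j ∈ N i then L else 0) else A i j with hB
      have hB0 : ∀ i j, 0 ≤ B i j := by
        intro i j
        simp only [hB]
        split_ifs
        exacts [hL, le_rfl, h0 i j]
      obtain ⟨c, hc, hlin⟩ := exists_permanent_updateRow_eq_sum B hB0 i
      obtain ⟨T, hT, hTle⟩ := exists_card_eq_sum_mul_le c (A i) hc L (h0 i) (hbd i) m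
        (by simpa using hm) (hrow i)
      refine ⟨Function.update N i T, fun k hk => ?_, hle.trans ?_⟩
      · rcases eq_or_ne k i with rfl | hki
        · simpa using hT
        · rw [Function.update_of_ne hki]
          exact hN k ((mem_insert.1 hk).resolve_left hki)
      · have e1 : B = B.updateRow i (A i) := by
          have : B i = A i := by
            funext j
            simp [hB, his]
          rw [← this, Matrix.updateRow_eq_self]
        rw [← hlin, ← hlin, ← e1] at hTle
        refine hTle.trans (le_of_eq ?_)
        congr 1
        ext k j
        rcases eq_or_ne k i with rfl | hki
        · simp
        · rw [Matrix.updateRow_ne hki]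
          simp [hB, hki]
  obtain ⟨N, hN, hle⟩ := main univ
  exact ⟨N, fun i => hN i (mem_univ i), by simpa using hle⟩

theorem permanent_indicator {n : ℕ} (L : ℝ) (N : Fin n → Finset (Fin n)) :
    permanent (fun i j => if j ∈ N i then L else 0) =
      L ^ n * (Finset.univ.filter fun e : Fin n ≃ Fin n => ∀ i, e i ∈ N i).card := by
  unfold permanent
  rw [Finset.card_filter]
  push_cast
  rw [Finset.mul_sum]
  refine Finset.sum_congr rfl fun e _ => ?_
  have : ∀ i, (if e i ∈ N i then L else 0) = L * if e i ∈ N i then 1 else 0 := by simp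
  simp only [this, Finset.prod_mul_distrib, Finset.prod_const, Finset.card_univ, Fintype.card_fin,
    Finset.prod_boole, Finset.mem_univ, true_imp_iff]

/-- `log (r!) / r`, the logarithm of the contribution of a row of sum `r` to the Bregman–Minc
bound. -/
def logFactorialDiv (r : ℕ) : ℝ := Real.log r.factorial / r

theorem logFactorialDiv_nonneg (r : ℕ) : 0 ≤ logFactorialDiv r :=
  div_nonneg (Real.log_nonneg (by exact_mod_cast r.factorial_pos)) r.cast_nonneg

theorem mul_logFactorialDiv (r : ℕ) : r * logFactorialDiv r = Real.log r.factorial := by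
  rcases eq_or_ne r 0 with rfl | hr
  · simp
  · rw [logFactorialDiv, mul_div_cancel₀]
    exact_mod_cast hr

open Finset in
/-- The entropy of a function with values in `N` is at most `log N.card`. -/
theorem card_mul_log_le_sum_log_fiber {ι κ : Type*} [DecidableEq κ] (S : Finset ι) (N : Finset κ)
    (f : ι → κ) (hf : ∀ e ∈ S, f e ∈ N) :
    S.card * Real.log S.card ≤
      ∑ e ∈ S, (Real.log N.card + Real.log (S.filter fun e' => f e' = f e).card) := by
  rcases S.eq_empty_or_nonempty with rfl | hS
  · simp
  have hSpos : (0 : ℝ) < S.card := by exact_mod_cast hS.card_pos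
  have hNpos : (0 : ℝ) < N.card := by
    obtain ⟨e, he⟩ := hS
    exact_mod_cast card_pos.2 ⟨_, hf e he⟩
  have hfib : ∀ e ∈ S, (0 : ℝ) < (S.filter fun e' => f e' = f e).card := fun e he => by
    exact Nat.cast_pos.2 (card_pos.2 ⟨e, mem_filter.2 ⟨he, rfl⟩⟩)
  have hterm : ∀ e ∈ S, Real.log S.card -
      (Real.log N.card + Real.log (S.filter fun e' => f e' = f e).card) ≤
      S.card / N.card * ((S.filter fun e' => f e' = f e).card : ℝ)⁻¹ - 1 := by
    intro e he
    have hp := hfib e he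
    rw [← Real.log_mul hNpos.ne' hp.ne', ← Real.log_div hSpos.ne' (mul_pos hNpos hp).ne']
    refine (Real.log_le_sub_one_of_pos (by positivity)).trans (le_of_eq ?_)
    field_simp
  have hinv : ∑ e ∈ S, ((S.filter fun e' => f e' = f e).card : ℝ)⁻¹ ≤ N.card := by
    rw [← sum_fiberwise_of_maps_to hf, card_eq_sum_ones, Nat.cast_sum]
    refine sum_le_sum fun k _ => ?_
    have : ∀ e ∈ S.filter (fun e => f e = k), ((S.filter fun e' => f e' = f e).card : ℝ)⁻¹ =
        ((S.filter fun e' => f e' = k).card : ℝ)⁻¹ := fun e he => by rw [(mem_filter.1 he).2]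
    rw [sum_congr rfl this, sum_const, nsmul_eq_mul, Nat.cast_one]
    exact mul_inv_le_one
  have hsum := sum_le_sum hterm
  rw [sum_sub_distrib, sum_sub_distrib, ← mul_sum, sum_const, sum_const, nsmul_eq_mul,
    nsmul_eq_mul, mul_one] at hsum
  have : (S.card : ℝ) / N.card * ∑ e ∈ S, ((S.filter fun e' => f e' = f e).card : ℝ)⁻¹ ≤
      S.card := by
    refine (mul_le_mul_of_nonneg_left hinv (by positivity)).trans (le_of_eq ?_)
    field_simp
  linarith

open Finset in
/-- Deleting a row and a column: bijections compatible with `N` sending `i` to `k` inject into the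
compatible bijections of the minor. -/
theorem card_filter_apply_eq_le_minor {α β : Type} [Fintype α] [Fintype β] [DecidableEq α]
    [DecidableEq β] (N : α → Finset β) (i : α) (k : β) :
    ((univ.filter fun e : α ≃ β => ∀ j, e j ∈ N j).filter fun e => e i = k).card ≤
      (univ.filter fun e : {x // x ≠ i} ≃ {y // y ≠ k} =>
        ∀ j, e j ∈ (N j.1).subtype (· ≠ k)).card := by
  have hiff : ∀ e : α ≃ β, e i = k → ∀ a, a ≠ i ↔ e a ≠ k := by
    rintro e rfl a
    simp
  have hne : ((univ.filter fun e : α ≃ β => ∀ j, e j ∈ N j).filter fun e => e i = k).Nonempty →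
      Nonempty ({x // x ≠ i} ≃ {y // y ≠ k}) := fun ⟨e, he⟩ =>
    ⟨e.subtypeEquiv (hiff e (mem_filter.1 he).2)⟩
  rcases ((univ.filter fun e : α ≃ β => ∀ j, e j ∈ N j).filter
    fun e => e i = k).eq_empty_or_nonempty with h | h
  · simp [h]
  obtain ⟨e₀⟩ := hne h
  refine card_le_card_of_injOn
    (fun e => if h : e i = k then e.subtypeEquiv (hiff e h) else e₀) ?_ ?_
  · intro e he
    simp only [coe_filter, mem_filter, mem_univ, true_and, Set.mem_ofPred_eq] at he
    simp [he.2, he.1]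
  · intro e he e' he' hee
    simp only [coe_filter, mem_filter, mem_univ, true_and, Set.mem_ofPred_eq] at he he'
    simp only [he.2, he'.2, dif_pos] at hee
    ext a
    by_cases ha : a = i
    · rw [ha, he.2, he'.2]
    · have := congrArg (fun g => (g ⟨a, ha⟩ : β)) hee
      simpa using this

open Finset in
/-- Summing the row contribution over all minors compatible with a fixed bijection. -/
theorem sum_erase_logFactorialDiv {α β : Type} [Fintype α] [Fintype β] [DecidableEq α]
    [DecidableEq β] (e : α ≃ β) (s : Finset β) (j : α) (hj : e j ∈ s) :
    Real.log s.card + ∑ i ∈ univ.erase j, logFactorialDiv (s.erase (e i)).card =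
      Fintype.card α * logFactorialDiv s.card := by
  obtain ⟨r, hr⟩ : ∃ r, s.card = r + 1 :=
    Nat.exists_eq_succ_of_ne_zero (card_ne_zero_of_mem hj)
  have hval : ∀ k, logFactorialDiv (s.erase k).card = logFactorialDiv (r + 1) +
      if k ∈ s then logFactorialDiv r - logFactorialDiv (r + 1) else 0 := by
    intro k
    split_ifs with hk
    · rw [card_erase_of_mem hk, hr]
      simp
    · rw [erase_eq_of_notMem hk, hr, add_zero]
  have hall : ∑ i, logFactorialDiv (s.erase (e i)).card =
      Fintype.card α * logFactorialDiv (r + 1) +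
        (r + 1) * (logFactorialDiv r - logFactorialDiv (r + 1)) := by
    rw [e.sum_comp (fun k => logFactorialDiv (s.erase k).card)]
    simp only [hval, sum_add_distrib]
    simp [hr, Fintype.card_congr e, mul_sub]
  have hsplit := add_sum_erase univ (fun i => logFactorialDiv (s.erase (e i)).card) (mem_univ j)
  rw [hall, hval, if_pos hj] at hsplit
  have h1 := mul_logFactorialDiv r
  have h2 := mul_logFactorialDiv (r + 1)
  rw [Nat.factorial_succ, Nat.cast_mul, Real.log_mul (by positivity) (by positivity)] at h2
  rw [hr]
  push_cast at h2 ⊢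
  linarith

open Finset in
/-- **Bregman–Minc inequality**, in logarithmic form. -/
theorem log_card_le_sum_logFactorialDiv (n : ℕ) : ∀ (α β : Type) [Fintype α] [Fintype β]
    [DecidableEq α] [DecidableEq β], Fintype.card α = n → ∀ N : α → Finset β,
    Real.log (univ.filter fun e : α ≃ β => ∀ i, e i ∈ N i).card ≤
      ∑ i, logFactorialDiv (N i).card := by
  induction n with
  | zero =>
    intro α β _ _ _ _ hα N
    have := Fintype.card_eq_zero_iff.1 hα
    have : (univ.filter fun e : α ≃ β => ∀ i, e i ∈ N i).card ≤ 1 :=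
      card_le_one.2 fun e _ e' _ => Equiv.ext fun a => isEmptyElim a
    rw [univ_eq_empty (α := α), sum_empty]
    exact Real.log_nonpos (Nat.cast_nonneg _) (by exact_mod_cast this)
  | succ n ih =>
    intro α β _ _ _ _ hα N
    set S := univ.filter fun e : α ≃ β => ∀ i, e i ∈ N i with hS
    rcases S.eq_empty_or_nonempty with h | hne
    · rw [h]
      simpa using sum_nonneg fun i _ => logFactorialDiv_nonneg (N i).card
    have hmem : ∀ e ∈ S, ∀ i, e i ∈ N i := fun e he => (mem_filter.1 he).2
    have hSpos : (0 : ℝ) < S.card := by exact_mod_cast hne.card_pos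
    have hminor : ∀ e ∈ S, ∀ i, Real.log (S.filter fun e' => e' i = e i).card ≤
        ∑ j ∈ univ.erase i, logFactorialDiv ((N j).erase (e i)).card := by
      intro e he i
      have hpos : (0 : ℝ) < (S.filter fun e' => e' i = e i).card := by
        exact Nat.cast_pos.2 (card_pos.2 ⟨e, mem_filter.2 ⟨he, rfl⟩⟩)
      refine (Real.log_le_log hpos
        (Nat.cast_le.2 (card_filter_apply_eq_le_minor N i (e i)))).trans ?_
      refine (ih {x // x ≠ i} {y // y ≠ e i} (by simp [Fintype.card_subtype_compl, hα])
        (fun j => (N j.1).subtype (· ≠ e i))).trans (le_of_eq ?_)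
      rw [← sum_subtype (univ.erase i) (fun x => by simp)
        (fun j => logFactorialDiv ((N j).subtype (· ≠ e i)).card)]
      exact sum_congr rfl fun j _ => by rw [card_subtype, filter_ne']
    have hent : ∀ i, S.card * Real.log S.card ≤ ∑ e ∈ S,
        (Real.log (N i).card + Real.log (S.filter fun e' => e' i = e i).card) := fun i =>
      card_mul_log_le_sum_log_fiber S (N i) (fun e => e i) fun e he => hmem e he i
    have hrow : ∀ e ∈ S,
        ∑ i, (Real.log (N i).card + Real.log (S.filter fun e' => e' i = e i).card) ≤
        (n + 1) * ∑ i, logFactorialDiv (N i).card := by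
      intro e he
      calc ∑ i, (Real.log (N i).card + Real.log (S.filter fun e' => e' i = e i).card)
          ≤ ∑ i, (Real.log (N i).card +
              ∑ j ∈ univ.erase i, logFactorialDiv ((N j).erase (e i)).card) :=
            sum_le_sum fun i _ => by gcongr; exact hminor e he i
        _ = ∑ j, (Real.log (N j).card +
              ∑ i ∈ univ.erase j, logFactorialDiv ((N j).erase (e i)).card) := by
            rw [sum_add_distrib, sum_add_distrib]
            congr 1
            exact sum_comm' fun i j => by simp [eq_comm]
        _ = ∑ j, (n + 1) * logFactorialDiv (N j).card := sum_congr rfl fun j _ => by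
            rw [sum_erase_logFactorialDiv e (N j) j (hmem e he j), hα]
            push_cast
            rfl
        _ = _ := by rw [mul_sum]
    have htot : (n + 1) * (S.card * Real.log S.card) ≤
        S.card * ((n + 1) * ∑ i, logFactorialDiv (N i).card) := by
      calc (n + 1) * (S.card * Real.log S.card)
          = ∑ _i : α, S.card * Real.log S.card := by simp [hα]
        _ ≤ ∑ i, ∑ e ∈ S, (Real.log (N i).card +
              Real.log (S.filter fun e' => e' i = e i).card) := sum_le_sum fun i _ => hent i
        _ ≤ ∑ _e ∈ S, (n + 1) * ∑ i, logFactorialDiv (N i).card := by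
            rw [sum_comm]
            exact sum_le_sum hrow
        _ = _ := by simp
    have hpos : (0 : ℝ) < (n + 1) * S.card := by positivity
    refine le_of_mul_le_mul_left ?_ hpos
    linarith

theorem log_factorial_le (m : ℕ) (hm : 1 ≤ m) :
    Real.log m.factorial ≤ m * Real.log m - m + Real.log m / 2 + 1 := by
  obtain ⟨k, rfl⟩ : ∃ k, m = k + 1 := ⟨m - 1, by omega⟩
  have h := Stirling.log_stirlingSeq'_antitone (Nat.zero_le k)
  simp only [Function.comp, Nat.succ_eq_add_one, Stirling.log_stirlingSeq_formula] at h
  have hk : (0 : ℝ) < ((k + 1 : ℕ) : ℝ) := by positivity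
  rw [Real.log_mul two_ne_zero hk.ne', Real.log_div hk.ne' (Real.exp_ne_zero 1),
    Real.log_exp] at h
  norm_num at h
  push_cast
  linarith

theorem le_log_factorial (n : ℕ) (hn : 1 ≤ n) :
    n * Real.log n - n + Real.log n / 2 ≤ Real.log n.factorial := by
  have hn0 : (0 : ℝ) < n := by exact_mod_cast hn
  have hpi : (1 : ℝ) ≤ 2 * Real.pi := by linarith [Real.pi_gt_three]
  have h := Real.log_le_log (by positivity) (Stirling.le_factorial_stirling n)
  rw [Real.log_mul (by positivity) (by positivity), Real.log_sqrt (by positivity),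
    Real.log_mul (by positivity) hn0.ne', Real.log_pow,
    Real.log_div hn0.ne' (Real.exp_ne_zero 1), Real.log_exp] at h
  linarith [Real.log_nonneg hpi]

/-- upper bound on permanents of row-stochastic matrices (scaled by `n`)
with entries bounded by `λ`. -/
theorem perm_upper_bound (lam : ℝ) (hlam : 1 < lam) (n : ℕ) (hn : 1 ≤ n)
    (A : Matrix (Fin n) (Fin n) ℝ)
    (h0 : ∀ i j, 0 ≤ A i j) (hbd : ∀ i j, A i j ≤ lam)
    (hrow : ∀ i, ∑ j, A i j = n) :
    permanent A ≤ Real.exp (2 * lam) * (n : ℝ) ^ ((lam - 1) / 2) * (Nat.factorial n) := by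
  have hl0 : 0 < lam := by linarith
  have hn0 : (0 : ℝ) < n := by exact_mod_cast hn
  set m := ⌈(n : ℝ) / lam⌉₊ with hmdef
  have hm1 : 1 ≤ m := Nat.ceil_pos.2 (by positivity)
  have hm0 : (0 : ℝ) < m := by exact_mod_cast hm1
  have hmn : m ≤ n := Nat.ceil_le.2 (div_le_self hn0.le hlam.le)
  have hnm : (n : ℝ) ≤ lam * m := by
    rw [mul_comm, ← div_le_iff₀ hl0]
    exact Nat.le_ceil _
  have hmlt : lam * m ≤ n + lam := by
    have := (Nat.ceil_lt_add_one (div_nonneg hn0.le hl0.le)).le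
    calc lam * m ≤ lam * (n / lam + 1) := by gcongr
      _ = n + lam := by field_simp
  obtain ⟨N, hN, hle⟩ := exists_permanent_le_permanent_indicator hmn hl0.le A h0 hbd
    fun i => (hrow i).trans_le hnm
  refine hle.trans ?_
  rw [permanent_indicator]
  set p := (Finset.univ.filter fun e : Fin n ≃ Fin n => ∀ i, e i ∈ N i).card with hp
  rcases Nat.eq_zero_or_pos p with hp0 | hp0
  · rw [hp0]
    simp only [Nat.cast_zero, mul_zero]
    positivity
  have hp0' : (0 : ℝ) < p := by exact_mod_cast hp0
  rw [← Real.log_le_log_iff (by positivity) (by positivity), Real.log_mul (by positivity) hp0'.ne',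
    Real.log_mul (by positivity) (by positivity), Real.log_mul (by positivity) (by positivity),
    Real.log_exp, Real.log_rpow hn0, Real.log_pow]
  have hbreg : Real.log p ≤ n * (Real.log m.factorial / m) := by
    have h := log_card_le_sum_logFactorialDiv n (Fin n) (Fin n) (by simp) N
    simp only [hN, Finset.sum_const, Finset.card_univ, Fintype.card_fin, nsmul_eq_mul,
      logFactorialDiv] at h
    convert h
  have hup : n * (Real.log m.factorial / m) ≤
      n * Real.log m - n + lam * (Real.log n / 2 + 1) := by
    have hlog : Real.log m ≤ Real.log n := Real.log_le_log hm0 (by exact_mod_cast hmn)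
    have hlogm : 0 ≤ Real.log m := Real.log_nonneg (by exact_mod_cast hm1)
    calc n * (Real.log m.factorial / m)
        ≤ n * ((m * Real.log m - m + Real.log m / 2 + 1) / m) := by
          gcongr
          exact log_factorial_le m hm1
      _ = n * Real.log m - n + n / m * (Real.log m / 2 + 1) := by
          field_simp
          ring
      _ ≤ _ := by
          gcongr
          rwa [div_le_iff₀ hm0]
  have hscale : n * (Real.log lam + Real.log m) ≤ n * Real.log n + lam := by
    have h := Real.log_le_sub_one_of_pos (x := lam * m / n) (by positivity)
    rw [Real.log_div (by positivity) hn0.ne', Real.log_mul hl0.ne' hm0.ne'] at h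
    have h' := mul_le_mul_of_nonneg_left h hn0.le
    have : (n : ℝ) * (lam * m / n - 1) = lam * m - n := by field_simp
    linarith
  linarith [le_log_factorial n hn]
end
end

section
/- Let λ > 1 and n ≥ 1, and let K be the set of n×n matrices A = (a_{ij}) with 0 ≤ a_{ij} ≤ λ for all i, j and every row sum equal to n. Then there exists A ∈ K such that perm(B) ≤ perm(A) for every B ∈ K, and such that for every row index i, at most one of the entries a_{i1}, …, a_{in} lies strictly between 0 and λ (all other entries of the row are equal to 0 or to λ). -/
noncomputable section

theorem continuous_permanent {n : ℕ} : Continuous (permanent (n := n)) := by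
  unfold permanent
  fun_prop

/-- The permanent is affine along directions supported in a single row. -/
theorem permanent_add_add_permanent_sub {n : ℕ} (A D : Matrix (Fin n) (Fin n) ℝ) (i : Fin n)
    (hD : ∀ a, a ≠ i → ∀ b, D a b = 0) :
    permanent (A + D) + permanent (A - D) = 2 * permanent A := by
  unfold permanent
  rw [← Finset.sum_add_distrib, Finset.mul_sum]
  refine Finset.sum_congr rfl fun π _ => ?_
  have hadd : ∏ a ∈ Finset.univ.erase i, (A + D) a (π a) =
      ∏ a ∈ Finset.univ.erase i, A a (π a) :=
    Finset.prod_congr rfl fun a ha => by simp [hD a (Finset.ne_of_mem_erase ha)]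
  have hsub : ∏ a ∈ Finset.univ.erase i, (A - D) a (π a) =
      ∏ a ∈ Finset.univ.erase i, A a (π a) :=
    Finset.prod_congr rfl fun a ha => by simp [hD a (Finset.ne_of_mem_erase ha)]
  rw [← Finset.mul_prod_erase _ _ (Finset.mem_univ i),
    ← Finset.mul_prod_erase _ (fun a => (A - D) a (π a)) (Finset.mem_univ i),
    ← Finset.mul_prod_erase _ (fun a => A a (π a)) (Finset.mem_univ i), hadd, hsub]
  simp only [Matrix.add_apply, Matrix.sub_apply]
  ring

theorem two_mul_sum_sq_lt {n : ℕ} (A D : Matrix (Fin n) (Fin n) ℝ) (hD : D ≠ 0) :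
    2 * ∑ i, ∑ j, A i j ^ 2 <
      (∑ i, ∑ j, (A + D) i j ^ 2) + ∑ i, ∑ j, (A - D) i j ^ 2 := by
  have hpos : 0 < ∑ i, ∑ j, D i j ^ 2 := by
    obtain ⟨i, j, hij⟩ : ∃ i j, D i j ≠ 0 := by
      by_contra! h
      exact hD (Matrix.ext h)
    refine Finset.sum_pos' (fun a _ => Finset.sum_nonneg fun b _ => sq_nonneg _)
      ⟨i, Finset.mem_univ i, Finset.sum_pos' (fun b _ => sq_nonneg _)
        ⟨j, Finset.mem_univ j, by positivity⟩⟩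
  have heq : (∑ i, ∑ j, (A + D) i j ^ 2) + ∑ i, ∑ j, (A - D) i j ^ 2 =
      2 * (∑ i, ∑ j, A i j ^ 2) + 2 * ∑ i, ∑ j, D i j ^ 2 := by
    simp only [Finset.mul_sum, ← Finset.sum_add_distrib, Matrix.add_apply, Matrix.sub_apply]
    refine Finset.sum_congr rfl fun i _ => Finset.sum_congr rfl fun j _ => ?_
    ring
  linarith

/-- The matrices with entries in `[0, lam]` and all row sums equal to `n`. -/
def boundedRowSumMatrices (lam : ℝ) (n : ℕ) : Set (Matrix (Fin n) (Fin n) ℝ) :=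
  {A | (∀ i j, 0 ≤ A i j ∧ A i j ≤ lam) ∧ ∀ i, ∑ j, A i j = n}

theorem isCompact_boundedRowSumMatrices (lam : ℝ) (n : ℕ) :
    IsCompact (boundedRowSumMatrices lam n) := by
  have hbox : IsCompact {A : Matrix (Fin n) (Fin n) ℝ | ∀ i, A i ∈ {v : Fin n → ℝ |
      ∀ j, v j ∈ Set.Icc 0 lam}} :=
    isCompact_pi_infinite fun _ => isCompact_pi_infinite fun _ => isCompact_Icc
  have hsum : IsClosed {A : Matrix (Fin n) (Fin n) ℝ | ∀ i, ∑ j, A i j = n} := by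
    simp only [Set.ofPred_forall]
    exact isClosed_iInter fun i => isClosed_eq (by fun_prop) continuous_const
  exact hbox.inter_right hsum

theorem nonempty_boundedRowSumMatrices {lam : ℝ} (hlam : 1 ≤ lam) (n : ℕ) :
    (boundedRowSumMatrices lam n).Nonempty :=
  ⟨fun _ _ => 1, fun _ _ => ⟨zero_le_one, hlam⟩, fun _ => by simp⟩

/-- Two entries of one row strictly between the bounds allow a nonzero two-sided perturbation
within that row. -/
theorem exists_perturbation {lam : ℝ} {n : ℕ} {A : Matrix (Fin n) (Fin n) ℝ}
    (hA : A ∈ boundedRowSumMatrices lam n) {i j k : Fin n} (hjk : j ≠ k)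
    (hj : 0 < A i j ∧ A i j < lam) (hk : 0 < A i k ∧ A i k < lam) :
    ∃ D : Matrix (Fin n) (Fin n) ℝ, D ≠ 0 ∧ (∀ a, a ≠ i → ∀ b, D a b = 0) ∧
      A + D ∈ boundedRowSumMatrices lam n ∧ A - D ∈ boundedRowSumMatrices lam n := by
  obtain ⟨t, ht, htj, htj', htk, htk'⟩ : ∃ t, 0 < t ∧ t ≤ A i j ∧ t ≤ lam - A i j ∧
      t ≤ A i k ∧ t ≤ lam - A i k := by
    refine ⟨min (min (A i j) (lam - A i j)) (min (A i k) (lam - A i k)), ?_, ?_, ?_, ?_, ?_⟩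
    · simp only [lt_min_iff, sub_pos]
      exact ⟨hj, hk⟩
    all_goals simp
  let D : Matrix (Fin n) (Fin n) ℝ := Matrix.single i j t - Matrix.single i k t
  have hoff : ∀ a, a ≠ i → ∀ b, D a b = 0 := fun a ha b => by
    simp [D, ha.symm]
  have hsum : ∀ a, ∑ b, D a b = 0 := fun a => by
    by_cases ha : i = a <;> simp [D, Matrix.single_apply, Finset.sum_sub_distrib, ha]
  have hbound : ∀ a b, |D a b| ≤ A a b ∧ |D a b| ≤ lam - A a b := by
    intro a b
    have hab := hA.1 a b
    by_cases ha : a = i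
    · subst ha
      by_cases hbj : b = j
      · subst hbj
        simp [D, hjk.symm, abs_of_pos ht, htj, htj']
      · by_cases hbk : b = k
        · subst hbk
          simp [D, hjk, abs_of_pos ht, htk, htk']
        · simpa [D, Matrix.single_apply, Ne.symm hbj, Ne.symm hbk] using hab
    · simpa [hoff a ha] using hab
  refine ⟨D, fun h => ?_, hoff, ⟨fun a b => ?_, fun a => ?_⟩, ⟨fun a b => ?_, fun a => ?_⟩⟩
  · have hDij := congrFun (congrFun h i) j
    simp [D, hjk.symm, ht.ne'] at hDij
  · obtain ⟨h₁, h₂⟩ := hbound a b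
    rw [abs_le] at h₁ h₂
    exact ⟨by simp only [Matrix.add_apply]; linarith, by simp only [Matrix.add_apply]; linarith⟩
  · simp [Finset.sum_add_distrib, hsum, hA.2]
  · obtain ⟨h₁, h₂⟩ := hbound a b
    rw [abs_le] at h₁ h₂
    exact ⟨by simp only [Matrix.sub_apply]; linarith, by simp only [Matrix.sub_apply]; linarith⟩
  · simp [Finset.sum_sub_distrib, hsum, hA.2]

/-- there is a permanent-maximizing matrix in which every row has at most
one entry strictly between `0` and `λ`. -/
theorem extremal_matrix_structure (lam : ℝ) (hlam : 1 < lam) (n : ℕ) (hn : 1 ≤ n) :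
    ∃ A : Matrix (Fin n) (Fin n) ℝ,
      (∀ i j, 0 ≤ A i j ∧ A i j ≤ lam) ∧ (∀ i, ∑ j, A i j = n) ∧
      (∀ B : Matrix (Fin n) (Fin n) ℝ,
        (∀ i j, 0 ≤ B i j ∧ B i j ≤ lam) → (∀ i, ∑ j, B i j = n) →
        permanent B ≤ permanent A) ∧
      (∀ i, (Finset.univ.filter fun j : Fin n => 0 < A i j ∧ A i j < lam).card ≤ 1) := by
  obtain ⟨M, hM, hMmax⟩ := (isCompact_boundedRowSumMatrices lam n).exists_isMaxOn
    (nonempty_boundedRowSumMatrices hlam.le n) continuous_permanent.continuousOn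
  -- Among all maximizers, choose one with the largest sum of squares of entries.
  have hcompact : IsCompact (boundedRowSumMatrices lam n ∩
      {A | permanent A = permanent M}) :=
    (isCompact_boundedRowSumMatrices lam n).inter_right
      (isClosed_eq continuous_permanent continuous_const)
  obtain ⟨A, ⟨hA, hAM⟩, hAmax⟩ := hcompact.exists_isMaxOn ⟨M, hM, rfl⟩
    (f := fun A => ∑ i, ∑ j, A i j ^ 2) (by fun_prop)
  have hperm : ∀ B ∈ boundedRowSumMatrices lam n, permanent B ≤ permanent A :=
    fun B hB => (hMmax hB).trans_eq (Eq.symm hAM)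
  refine ⟨A, hA.1, hA.2, fun B hB hB' => hperm B ⟨hB, hB'⟩, fun i => ?_⟩
  refine Finset.card_le_one.mpr fun j hj k hk => ?_
  by_contra hjk
  obtain ⟨D, hD, hoff, hadd, hsub⟩ := exists_perturbation hA hjk
    (Finset.mem_filter.mp hj).2 (Finset.mem_filter.mp hk).2
  have haff := permanent_add_add_permanent_sub A D i hoff
  have hlea := hperm _ hadd
  have hles := hperm _ hsub
  have hAM' : permanent A = permanent M := hAM
  have hsqa : ∑ i, ∑ j, (A + D) i j ^ 2 ≤ ∑ i, ∑ j, A i j ^ 2 :=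
    hAmax ⟨hadd, show permanent (A + D) = permanent M by linarith⟩
  have hsqs : ∑ i, ∑ j, (A - D) i j ^ 2 ≤ ∑ i, ∑ j, A i j ^ 2 :=
    hAmax ⟨hsub, show permanent (A - D) = permanent M by linarith⟩
  linarith [two_mul_sum_sq_lt A D hD]
end
end

section
/- Let (M_n)_{n≥1} be a sequence of matrices, where M_n is an n×n matrix with nonnegative entries admitting a Sinkhorn decomposition M_n = D_n G_n E_n, with D_n = diag(d₁,…,d_n) and E_n = diag(e₁,…,e_n) diagonal matrices with strictly positive diagonal entries and G_n ∈ Ω_n doubly stochastic. Then 1 ≤ liminf_{n→∞} per(M_n)/sm(M_n) and limsup_{n→∞} per(M_n)/sm(M_n) ≤ e. -/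
open Filter

noncomputable section

/-- The permanental mean `per(M) = (perm(M)/n!)^{1/n}`. -/
def permMean {n : ℕ} (M : Matrix (Fin n) (Fin n) ℝ) : ℝ :=
  (permanent M / (Nat.factorial n)) ^ ((n : ℝ)⁻¹)

/-- The scaling mean of an `n × n` matrix with nonnegative entries:
`sm(M) = (1/n²)·inf_{x,y > 0} (xᵀMy)/(gm(x)gm(y))`. -/
def scalingMeanMat {n : ℕ} (M : Matrix (Fin n) (Fin n) ℝ) : ℝ :=
  (1 / (n : ℝ) ^ 2) * sInf { r : ℝ | ∃ x y : Fin n → ℝ,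
    (∀ i, 0 < x i) ∧ (∀ i, 0 < y i) ∧
    r = (∑ i, ∑ j, x i * M i j * y j) /
        ((∏ i, x i) ^ ((n : ℝ)⁻¹) * (∏ i, y i) ^ ((n : ℝ)⁻¹)) }

/-- The mixed permanent of a list of vectors on a finite index set: the sum, over all ways of
choosing distinct indices from `S` for the vectors, of the product of the chosen entries. -/
def mixedPerm {ι : Type*} [DecidableEq ι] : List (ι → ℝ) → Finset ι → ℝ
  | [], _ => 1
  | c :: L, S => ∑ i ∈ S, c i * mixedPerm L (S.erase i)

section MixedPerm

variable {ι : Type*} [DecidableEq ι]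

theorem mixedPerm_cons (c : ι → ℝ) (L : List (ι → ℝ)) (S : Finset ι) :
    mixedPerm (c :: L) S = ∑ i ∈ S, c i * mixedPerm L (S.erase i) := rfl

theorem mixedPerm_swap (x y : ι → ℝ) (L : List (ι → ℝ)) (S : Finset ι) :
    mixedPerm (x :: y :: L) S = mixedPerm (y :: x :: L) S := by
  simp only [mixedPerm_cons, Finset.mul_sum]
  rw [Finset.sum_comm' (t' := S) (s' := fun j => S.erase j)]
  · refine Finset.sum_congr rfl fun j _ => Finset.sum_congr rfl fun i _ => ?_
    rw [Finset.erase_right_comm]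
    ring
  · intro i j
    simp only [Finset.mem_erase]
    tauto

theorem mixedPerm_perm {L L' : List (ι → ℝ)} (h : L.Perm L') (S : Finset ι) :
    mixedPerm L S = mixedPerm L' S := by
  induction h generalizing S with
  | nil => rfl
  | cons x _ ih => simp only [mixedPerm_cons, ih]
  | swap x y L => exact mixedPerm_swap _ _ _ _
  | trans _ _ ih₁ ih₂ => rw [ih₁, ih₂]

theorem mixedPerm_cons_add_smul (x y : ι → ℝ) (t : ℝ) (L : List (ι → ℝ)) (S : Finset ι) :
    mixedPerm ((x + t • y) :: L) S = mixedPerm (x :: L) S + t * mixedPerm (y :: L) S := by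
  simp only [mixedPerm_cons, Finset.mul_sum, ← Finset.sum_add_distrib, Pi.add_apply,
    Pi.smul_apply, smul_eq_mul]
  exact Finset.sum_congr rfl fun i _ => by ring

theorem mixedPerm_pos {L : List (ι → ℝ)} (hL : ∀ c ∈ L, ∀ i, 0 < c i) {S : Finset ι}
    (hS : L.length ≤ S.card) : 0 < mixedPerm L S := by
  induction L generalizing S with
  | nil => exact one_pos
  | cons c L ih =>
    rw [List.length_cons] at hS
    refine Finset.sum_pos (fun i hi => mul_pos (hL c (by simp) i) (ih ?_ ?_)) ?_
    · exact fun c' hc' => hL c' (by simp [hc'])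
    · rw [Finset.card_erase_of_mem hi]; lia
    · exact Finset.card_pos.mp (by lia)

theorem mixedPerm_replicate (w : ι → ℝ) (S : Finset ι) :
    mixedPerm (List.replicate S.card w) S = S.card.factorial * ∏ i ∈ S, w i := by
  generalize h : S.card = m
  induction m generalizing S with
  | zero => simp [Finset.card_eq_zero.mp h, mixedPerm]
  | succ m ih =>
    rw [List.replicate_succ, mixedPerm_cons,
      Finset.sum_congr rfl (g := fun _ => (m.factorial : ℝ) * ∏ i ∈ S, w i)]
    · rw [Finset.sum_const, h, nsmul_eq_mul, Nat.factorial_succ]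
      push_cast
      ring
    · intro i hi
      rw [ih (S.erase i) (by rw [Finset.card_erase_of_mem hi, h]; rfl),
        ← Finset.mul_prod_erase S w hi]
      ring

theorem mixedPerm_ofFn [Fintype ι] {k : ℕ} (c : Fin k → ι → ℝ) (S : Finset ι) :
    mixedPerm (List.ofFn c) S = ∑ f : Fin k → ι,
      open Classical in if Function.Injective f ∧ ∀ j, f j ∈ S then ∏ j, c j (f j) else 0 := by
  classical
  induction k generalizing S with
  | zero => simp [mixedPerm, Function.injective_of_subsingleton]
  | succ k ih =>
    rw [List.ofFn_succ, mixedPerm_cons, ← (Fin.consEquiv fun _ => ι).sum_comp,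
      Fintype.sum_prod_type, ← Finset.sum_subset (Finset.subset_univ S)]
    · refine Finset.sum_congr rfl fun i hi => ?_
      rw [ih, Finset.mul_sum]
      refine Finset.sum_congr rfl fun f _ => ?_
      rw [mul_ite, mul_zero]
      refine if_congr ?_ ?_ rfl
      · have hcons : Fin.consEquiv (fun _ => ι) (i, f) = Fin.cons i f := rfl
        simp only [hcons, Fin.cons_injective_iff, Fin.forall_fin_succ, Fin.cons_zero,
          Fin.cons_succ, Finset.mem_erase, Set.mem_range, not_exists]
        refine ⟨fun h => ⟨⟨fun j => (h.2 j).1, h.1⟩, hi, fun j => (h.2 j).2⟩,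
          fun h => ⟨h.1.2, fun j => ⟨h.1.1 j, h.2.2 j⟩⟩⟩
      · simp [Fin.prod_univ_succ]
    · intro i _ hi
      refine Finset.sum_eq_zero fun f _ => if_neg fun h => hi ?_
      simpa using h.2 0

end MixedPerm

/-- A nonnegative symmetric matrix with positive off-diagonal entries satisfying a Bochner-type
inequality with respect to a positive vector `c` is negative semidefinite on the
`A`-orthogonal complement of `c`. -/
theorem sum_mul_mul_nonpos_of_bochner {κ : Type*} [Fintype κ] (A : κ → κ → ℝ)
    (hsymm : ∀ i j, A i j = A j i) (hpos : ∀ i j, i ≠ j → 0 < A i j)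
    (c : κ → ℝ) (hc : ∀ i, 0 < c i) (hAc : ∀ i, 0 < ∑ j, A i j * c j)
    (hB : ∀ y : κ → ℝ, ∑ i, y i * ∑ j, A i j * y j ≤
      ∑ i, c i * ((∑ j, A i j * y j) ^ 2 / ∑ j, A i j * c j))
    (z : κ → ℝ) (hz : ∑ i, z i * ∑ j, A i j * c j = 0) :
    ∑ i, z i * ∑ j, A i j * z j ≤ 0 := by
  classical
  obtain ⟨p, hp⟩ : ∃ p : κ → ℝ, p = fun i => (∑ j, A i j * c j) / c i := ⟨_, rfl⟩
  have hpc : ∀ i, ∑ j, A i j * c j = p i * c i := fun i => by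
    rw [hp]; field_simp [(hc i).ne']
  have hp0 : ∀ i, 0 < p i := fun i => by rw [hp]; exact div_pos (hAc i) (hc i)
  simp only [hpc] at hB hz
  have eig : ∀ (l : ℝ) (y : κ → ℝ), (∀ i, ∑ j, A i j * y j = l * (p i * y i)) → y ≠ 0 →
      l ≤ 0 ∨ ∑ i, p i * y i * z i = 0 := by
    intro l y hy hy0
    have hN : 0 < ∑ i, p i * y i ^ 2 := by
      obtain ⟨i, hi⟩ := Function.ne_iff.mp hy0
      refine Finset.sum_pos' (fun i _ => mul_nonneg (hp0 i).le (sq_nonneg _))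
        ⟨i, Finset.mem_univ _, mul_pos (hp0 i) (sq_pos_of_ne_zero hi)⟩
    have h1 := hB y
    simp only [hy] at h1
    have e1 : ∑ i, y i * (l * (p i * y i)) = l * ∑ i, p i * y i ^ 2 := by
      rw [Finset.mul_sum]; exact Finset.sum_congr rfl fun i _ => by ring
    have e2 : ∑ i, c i * ((l * (p i * y i)) ^ 2 / (p i * c i)) = l ^ 2 * ∑ i, p i * y i ^ 2 := by
      rw [Finset.mul_sum]
      refine Finset.sum_congr rfl fun i _ => ?_
      have := (hc i).ne'
      have := (hp0 i).ne'
      field_simp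
    rw [e1, e2] at h1
    have h2 : l ≤ l ^ 2 := le_of_mul_le_mul_right h1 hN
    have e3 : ∑ i, ∑ j, A i j * (c i * c j * (y i / c i - y j / c j) ^ 2) =
        2 * ((1 - l) * ∑ i, p i * y i ^ 2) := by
      have : ∀ i j, A i j * (c i * c j * (y i / c i - y j / c j) ^ 2) =
          y i ^ 2 / c i * (A i j * c j) + y j ^ 2 / c j * (A j i * c i) -
            2 * (y i * (A i j * y j)) := by
        intro i j
        have := (hc i).ne'
        have := (hc j).ne'
        rw [hsymm j i]
        field_simp
        ring
      simp only [this, Finset.sum_sub_distrib, Finset.sum_add_distrib]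
      rw [Finset.sum_comm (f := fun i j => y j ^ 2 / c j * (A j i * c i))]
      simp only [← Finset.mul_sum, hpc, hy, e1]
      have : ∑ i, y i ^ 2 / c i * (p i * c i) = ∑ i, p i * y i ^ 2 :=
        Finset.sum_congr rfl fun i _ => by have := (hc i).ne'; field_simp
      rw [this]
      ring
    have hterm : ∀ i j, 0 ≤ A i j * (c i * c j * (y i / c i - y j / c j) ^ 2) := by
      intro i j
      rcases eq_or_ne i j with rfl | hij
      · simp
      · have := hpos i j hij
        have := hc i
        have := hc j
        positivity
    rcases le_or_gt l 0 with hl | hl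
    · exact .inl hl
    right
    have hl1 : 1 ≤ l := by nlinarith
    have hsum : ∑ i, ∑ j, A i j * (c i * c j * (y i / c i - y j / c j) ^ 2) = 0 := by
      refine le_antisymm ?_ (Finset.sum_nonneg fun i _ => Finset.sum_nonneg fun j _ => hterm i j)
      rw [e3]
      nlinarith
    have heq : ∀ i j, y i / c i = y j / c j := by
      intro i j
      rcases eq_or_ne i j with rfl | hij
      · rfl
      have h3 := (Finset.sum_eq_zero_iff_of_nonneg fun i _ =>
        Finset.sum_nonneg fun j _ => hterm i j).mp hsum i (Finset.mem_univ _)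
      have h4 := (Finset.sum_eq_zero_iff_of_nonneg fun j _ => hterm i j).mp h3 j
        (Finset.mem_univ _)
      have h5 := (mul_eq_zero.mp h4).resolve_left (hpos i j hij).ne'
      have h6 := (mul_eq_zero.mp h5).resolve_left (mul_pos (hc i) (hc j)).ne'
      exact sub_eq_zero.mp (pow_eq_zero_iff two_ne_zero |>.mp h6)
    obtain ⟨i₀, -⟩ := Function.ne_iff.mp hy0
    have : ∀ i, p i * y i * z i = y i₀ / c i₀ * (z i * (p i * c i)) := by
      intro i
      rw [← heq i i₀]
      have := (hc i).ne'
      field_simp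
    simp only [this, ← Finset.mul_sum, hz, mul_zero]
  obtain ⟨s, hs⟩ : ∃ s : κ → ℝ, s = fun i => √(p i) := ⟨_, rfl⟩
  have hs0 : ∀ i, 0 < s i := fun i => by rw [hs]; exact Real.sqrt_pos.mpr (hp0 i)
  have hsp : ∀ i, p i = s i * s i := fun i => by rw [hs]; exact (Real.mul_self_sqrt (hp0 i).le).symm
  let T : Matrix κ κ ℝ := Matrix.of fun i j => A i j / (s i * s j)
  have hT : T.IsHermitian := by
    ext i j
    simp [T, hsymm j i, mul_comm]
  let b := hT.eigenvectorBasis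
  let w : EuclideanSpace ℝ κ := WithLp.toLp 2 fun i => s i * z i
  have hTw : ∀ i, (T.mulVec w.ofLp) i = (∑ j, A i j * z j) / s i := by
    intro i
    simp only [Matrix.mulVec, dotProduct, T, Matrix.of_apply, w, Finset.sum_div]
    refine Finset.sum_congr rfl fun j _ => ?_
    have := (hs0 i).ne'
    have := (hs0 j).ne'
    field_simp
  have hform : ∑ i, z i * ∑ j, A i j * z j = inner ℝ w (WithLp.toLp 2 (T.mulVec w.ofLp)) := by
    simp only [PiLp.inner_apply, RCLike.inner_apply, conj_trivial, hTw, w]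
    refine Finset.sum_congr rfl fun i _ => ?_
    have := (hs0 i).ne'
    field_simp
  rw [hform, ← b.sum_inner_mul_inner]
  refine Finset.sum_nonpos fun k _ => ?_
  have hk : T.mulVec (b k).ofLp = hT.eigenvalues k • (b k).ofLp := hT.mulVec_eigenvectorBasis k
  have hinner : inner ℝ (b k) (WithLp.toLp 2 (T.mulVec w.ofLp)) =
      hT.eigenvalues k * inner ℝ w (b k) := by
    have e1 : inner ℝ (b k) (WithLp.toLp 2 (T.mulVec w.ofLp)) =
        (b k).ofLp ⬝ᵥ T.mulVec w.ofLp := by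
      simp [PiLp.inner_apply, dotProduct, mul_comm]
    have hTt : T.transpose = T := by simpa [Matrix.IsSymm] using hT
    rw [e1, Matrix.dotProduct_mulVec, ← Matrix.mulVec_transpose, hTt, hk, smul_dotProduct]
    simp [PiLp.inner_apply, dotProduct, mul_comm]
  rw [hinner]
  have hy := eig (hT.eigenvalues k) (fun i => (b k).ofLp i / s i) ?_ ?_
  · rcases hy with h | h
    · nlinarith [mul_nonneg (neg_nonneg.mpr h) (mul_self_nonneg (inner ℝ w (b k)))]
    · have : inner ℝ w (b k) = 0 := by
        rw [← h]
        simp only [PiLp.inner_apply, RCLike.inner_apply, conj_trivial, w, hsp]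
        refine Finset.sum_congr rfl fun i _ => ?_
        have := (hs0 i).ne'
        field_simp
      simp [this]
  · intro i
    have h := congrFun hk i
    simp only [Matrix.mulVec, dotProduct, T, Matrix.of_apply, Pi.smul_apply, smul_eq_mul] at h
    rw [hsp]
    have hsi := (hs0 i).ne'
    have : ∑ j, A i j * ((b k).ofLp j / s j) = s i * ∑ j, A i j / (s i * s j) * (b k).ofLp j := by
      rw [Finset.mul_sum]
      refine Finset.sum_congr rfl fun j _ => ?_
      have := (hs0 j).ne'
      field_simp
    rw [this, h]
    field_simp
  · intro h
    apply b.orthonormal.ne_zero k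
    ext i
    have := congrFun h i
    simpa [(hs0 i).ne'] using this

section AlexandrovFenchel

variable {ι : Type*} [DecidableEq ι]

/-- The inductive step of the Alexandrov–Fenchel inequality for permanents: the inequality for all
the one-element deletions of `S` forces the mixed permanent to be negative semidefinite on the
orthogonal complement of `c`. -/
theorem mixedPerm_nonpos_of_orthogonal {c : ι → ℝ} {L : List (ι → ℝ)} (hc : ∀ i, 0 < c i)
    (hL : ∀ d ∈ L, ∀ i, 0 < d i) {S : Finset ι} (hS : S.card = L.length + 3)
    (ih : ∀ i ∈ S, ∀ y : ι → ℝ, mixedPerm (c :: c :: L) (S.erase i) *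
      mixedPerm (y :: y :: L) (S.erase i) ≤ mixedPerm (c :: y :: L) (S.erase i) ^ 2)
    {z : ι → ℝ} (hz : mixedPerm (z :: c :: c :: L) S = 0) :
    mixedPerm (z :: z :: c :: L) S ≤ 0 := by
  have hcL : ∀ d ∈ c :: L, ∀ i, 0 < d i := by simpa using ⟨hc, hL⟩
  have hccL : ∀ d ∈ c :: c :: L, ∀ i, 0 < d i := by simpa using ⟨hc, hL⟩
  let A : S → S → ℝ := fun i j =>
    if i.1 = j.1 then 0 else mixedPerm (c :: L) ((S.erase i).erase j)
  have hA : ∀ (y : ι → ℝ) (i : S), ∑ j : S, A i j * y j = mixedPerm (y :: c :: L) (S.erase i) := by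
    intro y i
    have h := Finset.sum_coe_sort S fun j =>
      (if i.1 = j then 0 else mixedPerm (c :: L) ((S.erase i).erase j)) * y j
    refine h.trans ?_
    rw [mixedPerm_cons, ← Finset.sum_erase S (a := i.1) (by simp)]
    refine Finset.sum_congr rfl fun j hj => ?_
    rw [if_neg (Finset.ne_of_mem_erase hj).symm, mul_comm]
  have hsum : ∀ x y : ι → ℝ, ∑ i : S, x i * ∑ j : S, A i j * y j =
      mixedPerm (x :: y :: c :: L) S := by
    intro x y
    simp only [hA]
    exact Finset.sum_coe_sort S fun i => x i * mixedPerm (y :: c :: L) (S.erase i)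
  have hAc : ∀ i : S, 0 < mixedPerm (c :: c :: L) (S.erase i) := fun i =>
    mixedPerm_pos hccL (by rw [Finset.card_erase_of_mem i.2, hS]; simp)
  rw [← hsum]
  refine sum_mul_mul_nonpos_of_bochner A ?_ ?_ (fun i => c i) (fun i => hc i) ?_ ?_ (fun i => z i) ?_
  · intro i j
    simp only [A, eq_comm (a := i.1), Finset.erase_right_comm (a := i.1)]
  · intro i j hij
    have hij' : i.1 ≠ j.1 := fun h => hij (Subtype.ext h)
    simp only [A, if_neg hij']
    refine mixedPerm_pos hcL ?_
    rw [Finset.card_erase_of_mem (Finset.mem_erase.mpr ⟨hij'.symm, j.2⟩),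
      Finset.card_erase_of_mem i.2, hS]
    simp
  · intro i
    rw [hA]
    exact hAc i
  · intro y
    obtain ⟨y', hy'⟩ : ∃ y' : ι → ℝ, ∀ i : S, y i = y' i :=
      ⟨fun i => if h : i ∈ S then y ⟨i, h⟩ else 0, fun i => by simp⟩
    simp only [hy']
    rw [hsum]
    simp only [hA]
    rw [mixedPerm_perm (L' := c :: y' :: y' :: L) ?_ S, mixedPerm_cons, ← Finset.sum_coe_sort]
    · refine Finset.sum_le_sum fun i _ => mul_le_mul_of_nonneg_left ?_ (hc i).le
      rw [le_div_iff₀ (hAc i), mul_comm, mixedPerm_swap y' c]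
      exact ih i i.2 y'
    · exact ((List.Perm.swap c y' L).cons y').trans (List.Perm.swap c y' (y' :: L))
  · rw [hsum]
    exact hz

/-- The Alexandrov–Fenchel inequality for permanents. -/
theorem mixedPerm_mul_le_sq {L : List (ι → ℝ)} (hL : ∀ c ∈ L, ∀ i, 0 < c i) {S : Finset ι}
    (hS : S.card = L.length + 2) {u : ι → ℝ} (hu : ∀ i, 0 < u i) (y : ι → ℝ) :
    mixedPerm (u :: u :: L) S * mixedPerm (y :: y :: L) S ≤ mixedPerm (u :: y :: L) S ^ 2 := by
  induction L generalizing S u y with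
  | nil =>
    obtain ⟨i, j, hij, rfl⟩ := Finset.card_eq_two.mp hS
    have h1 : ({i, j} : Finset ι).erase i = {j} := by grind
    have h2 : ({i, j} : Finset ι).erase j = {i} := by grind
    simp only [Finset.sum_pair hij, h1, h2, Finset.sum_singleton, mixedPerm]
    nlinarith [sq_nonneg (u i * y j - u j * y i)]
  | cons c L ih =>
    have hc : ∀ i, 0 < c i := hL c (by simp)
    have hL' : ∀ d ∈ L, ∀ i, 0 < d i := fun d hd => hL d (by simp [hd])
    have orth : ∀ z, mixedPerm (z :: c :: c :: L) S = 0 → mixedPerm (z :: z :: c :: L) S ≤ 0 :=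
      fun z => mixedPerm_nonpos_of_orthogonal hc hL' hS fun i hi y =>
        ih hL' (by rw [Finset.card_erase_of_mem hi, hS]; rfl) hc y
    have hα : 0 < mixedPerm (u :: c :: c :: L) S :=
      mixedPerm_pos (by simpa using ⟨hu, hc, hL'⟩) (by rw [hS]; simp)
    have hU : 0 < mixedPerm (u :: u :: c :: L) S :=
      mixedPerm_pos (by simpa using ⟨hu, hc, hL'⟩) (by rw [hS]; simp)
    have hlin : ∀ (a b : ℝ) (w : ι → ℝ), mixedPerm ((a • u + b • y) :: w :: c :: L) S =
        a * mixedPerm (u :: w :: c :: L) S + b * mixedPerm (y :: w :: c :: L) S := by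
      intro a b w
      have h := mixedPerm_cons_add_smul 0 u a (w :: c :: L) S
      rw [zero_add] at h
      rw [mixedPerm_cons_add_smul, h]
      simp [mixedPerm_cons]
    have h := orth (mixedPerm (y :: c :: c :: L) S • u + (-mixedPerm (u :: c :: c :: L) S) • y)
      (by rw [hlin]; ring)
    rw [hlin, mixedPerm_swap u (_ + _), mixedPerm_swap y (_ + _), hlin, hlin,
      mixedPerm_swap y u] at h
    set α := mixedPerm (u :: c :: c :: L) S
    set β := mixedPerm (y :: c :: c :: L) S
    set U := mixedPerm (u :: u :: c :: L) S
    set W := mixedPerm (u :: y :: c :: L) S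
    set Y := mixedPerm (y :: y :: c :: L) S
    have h2 : α ^ 2 * (U * Y) ≤ α ^ 2 * W ^ 2 := by
      nlinarith [sq_nonneg (β * U - α * W), mul_le_mul_of_nonneg_left h hU.le]
    exact le_of_mul_le_mul_left h2 (by positivity)

end AlexandrovFenchel

theorem le_mul_div_pow_of_mul_le_sq {N : ℕ → ℝ} {k : ℕ} (hpos : ∀ m ≤ k, 0 < N m)
    (hN : ∀ m, m + 2 ≤ k → N m * N (m + 2) ≤ N (m + 1) ^ 2) :
    N k ≤ N 0 * (N 1 / N 0) ^ k := by
  have ratio : ∀ m, m + 1 ≤ k → N (m + 1) ≤ N 1 / N 0 * N m := by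
    intro m hm
    induction m with
    | zero => rw [div_mul_cancel₀ _ (hpos 0 (by lia)).ne']
    | succ m ih =>
      have h0 := hpos m (by lia)
      have h1 := hpos (m + 1) (by lia)
      refine le_of_mul_le_mul_left ?_ h0
      calc N m * N (m + 2) ≤ N (m + 1) * N (m + 1) := by rw [← sq]; exact hN m hm
        _ ≤ N (m + 1) * (N 1 / N 0 * N m) := mul_le_mul_of_nonneg_left (ih (by lia)) h1.le
        _ = N m * (N 1 / N 0 * N (m + 1)) := by ring
  have key : ∀ m ≤ k, N m ≤ N 0 * (N 1 / N 0) ^ m := by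
    intro m hm
    induction m with
    | zero => simp
    | succ m ih =>
      have h0 := hpos 0 (by lia)
      have h1 := hpos 1 (by lia)
      calc N (m + 1) ≤ N 1 / N 0 * N m := ratio m hm
        _ ≤ N 1 / N 0 * (N 0 * (N 1 / N 0) ^ m) :=
          mul_le_mul_of_nonneg_left (ih (by lia)) (by positivity)
        _ = N 0 * (N 1 / N 0) ^ (m + 1) := by ring
  exact key k le_rfl

section Capacity

variable {ι : Type*} [DecidableEq ι]

theorem mixedPerm_replicate_le {k : ℕ} {u v : ι → ℝ} (hu : ∀ i, 0 < u i) (hv : ∀ i, 0 < v i)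
    {L : List (ι → ℝ)} (hL : ∀ c ∈ L, ∀ i, 0 < c i) {S : Finset ι}
    (hS : S.card = k + 1 + L.length) :
    mixedPerm (List.replicate (k + 1) v ++ L) S ≤
      mixedPerm (List.replicate (k + 1) u ++ L) S *
        (mixedPerm (v :: (List.replicate k u ++ L)) S /
          mixedPerm (List.replicate (k + 1) u ++ L) S) ^ (k + 1) := by
  have hmem : ∀ a b : ℕ, ∀ c ∈ List.replicate a v ++ (List.replicate b u ++ L), ∀ i, 0 < c i := by
    intro a b c hc
    simp only [List.mem_append, List.mem_replicate] at hc
    rcases hc with ⟨-, rfl⟩ | ⟨-, rfl⟩ | hc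
    exacts [hv, hu, hL c hc]
  have h := le_mul_div_pow_of_mul_le_sq (k := k + 1)
    (N := fun m => mixedPerm (List.replicate m v ++ (List.replicate (k + 1 - m) u ++ L)) S) ?_ ?_
  · simpa using h
  · intro m hm
    refine mixedPerm_pos (hmem _ _) ?_
    simp only [List.length_append, List.length_replicate]
    lia
  · intro m hm
    obtain ⟨j, hj⟩ : ∃ j, k + 1 = m + 2 + j := ⟨_, (Nat.add_sub_of_le hm).symm⟩
    have e0 : k + 1 - m = j + 2 := by lia
    have e1 : k + 1 - (m + 1) = j + 1 := by lia
    have e2 : k + 1 - (m + 2) = j := by lia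
    simp only [e0, e1, e2]
    have h := mixedPerm_mul_le_sq (hmem m j) (S := S) (by simp; lia) hu v
    refine le_trans (le_of_eq ?_) (h.trans (le_of_eq ?_))
    · congr 1
      refine mixedPerm_perm ?_ S
      rw [List.replicate_succ, List.replicate_succ]
      exact List.perm_middle.trans (List.perm_middle.cons _)
    · congr 1
      refine mixedPerm_perm ?_ S
      rw [List.replicate_succ, List.replicate_succ]
      exact (List.Perm.swap _ _ _).trans (List.perm_middle.symm.cons _)

/-- The Gurvits capacity inequality: eliminating one variable. -/
theorem capacity_step {k : ℕ} (hk : 1 ≤ k) {κ : ℝ} {u r : ι → ℝ} (hu : ∀ i, 0 < u i)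
    (hr : ∀ i, 0 < r i) {L : List (ι → ℝ)} (hL : ∀ c ∈ L, ∀ i, 0 < c i) {S : Finset ι}
    (hS : S.card = k + 1 + L.length)
    (h : ∀ t > 0, κ * t ≤ mixedPerm (List.replicate (k + 1) (u + t • r) ++ L) S) :
    κ * k ^ k / (k + 1) ^ (k + 1) ≤ mixedPerm (List.replicate k u ++ r :: L) S := by
  have hk0 : (0 : ℝ) < k := by exact_mod_cast hk
  have hN1 : mixedPerm (List.replicate k u ++ r :: L) S =
      mixedPerm (r :: (List.replicate k u ++ L)) S := mixedPerm_perm List.perm_middle S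
  have hN1pos : 0 < mixedPerm (List.replicate k u ++ r :: L) S := by
    refine mixedPerm_pos (fun c hc => ?_) (by simp; lia)
    simp only [List.mem_append, List.mem_replicate, List.mem_cons] at hc
    rcases hc with ⟨-, rfl⟩ | rfl | hc
    exacts [hu, hr, hL c hc]
  have hN0pos : 0 < mixedPerm (List.replicate (k + 1) u ++ L) S := by
    refine mixedPerm_pos (fun c hc => ?_) (by simp; lia)
    simp only [List.mem_append, List.mem_replicate] at hc
    rcases hc with ⟨-, rfl⟩ | hc
    exacts [hu, hL c hc]
  have key : ∀ t > 0, κ * t ≤ mixedPerm (List.replicate (k + 1) u ++ L) S *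
      ((mixedPerm (List.replicate (k + 1) u ++ L) S +
        t * mixedPerm (List.replicate k u ++ r :: L) S) /
          mixedPerm (List.replicate (k + 1) u ++ L) S) ^ (k + 1) := by
    intro t ht
    have hv : ∀ i, 0 < (u + t • r) i := fun i => by
      have := hu i; have := hr i; simp only [Pi.add_apply, Pi.smul_apply, smul_eq_mul]; positivity
    have h2 := (h t ht).trans (mixedPerm_replicate_le hu hv hL hS)
    rwa [mixedPerm_cons_add_smul, ← hN1, ← List.cons_append, ← List.replicate_succ] at h2
  set N₀ := mixedPerm (List.replicate (k + 1) u ++ L) S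
  set N₁ := mixedPerm (List.replicate k u ++ r :: L) S
  have h3 := key (N₀ / (k * N₁)) (by positivity)
  have e : (N₀ + N₀ / (k * N₁) * N₁) / N₀ = (k + 1) / k := by field_simp
  rw [e, div_pow] at h3
  rw [div_le_iff₀ (by positivity)]
  have e2 : κ * k ^ k = κ * (N₀ / (k * N₁)) * (N₁ * k ^ (k + 1) / N₀) := by
    field_simp
    ring
  have e3 : N₁ * (k + 1 : ℝ) ^ (k + 1) =
      N₀ * ((k + 1) ^ (k + 1) / k ^ (k + 1)) * (N₁ * k ^ (k + 1) / N₀) := by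
    field_simp
  rw [e2, e3]
  exact mul_le_mul_of_nonneg_right h3 (by positivity)

/-- The Gurvits capacity bound for mixed permanents. -/
theorem capacity_le_mixedPerm {k : ℕ} {κ : ℝ} (r : Fin (k + 1) → ι → ℝ) (hr : ∀ j i, 0 < r j i)
    {L : List (ι → ℝ)} (hL : ∀ c ∈ L, ∀ i, 0 < c i) {S : Finset ι}
    (hS : S.card = k + 1 + L.length)
    (h : ∀ x : Fin (k + 1) → ℝ, (∀ j, 0 < x j) →
      κ * ∏ j, x j ≤ mixedPerm (List.replicate (k + 1) (∑ j, x j • r j) ++ L) S) :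
    κ / (k + 1) ^ (k + 1) ≤ mixedPerm (List.ofFn r ++ L) S := by
  induction k generalizing κ L with
  | zero => simpa using h 1 fun _ => one_pos
  | succ k ih =>
    rw [List.ofFn_succ_last, List.append_assoc, List.singleton_append]
    have h2 := ih (κ := κ * (k + 1 : ℕ) ^ (k + 1) / ((k + 1 : ℕ) + 1) ^ (k + 1 + 1))
      (L := r (Fin.last _) :: L) (fun j => r j.castSucc) (fun j => hr _)
      (by simpa using ⟨hr _, hL⟩) (by simp; lia) ?_
    · refine le_trans (le_of_eq ?_) h2
      push_cast
      field_simp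
    · intro x hx
      have hu : ∀ i, 0 < (∑ j, x j • r j.castSucc) i := fun i => by
        rw [Finset.sum_apply]
        exact Finset.sum_pos (fun j _ => mul_pos (hx j) (hr _ _)) Finset.univ_nonempty
      refine le_trans (le_of_eq ?_) (capacity_step (κ := κ * ∏ j, x j) (by lia) hu
        (hr (Fin.last _)) hL (by lia) ?_)
      · ring
      · intro t ht
        have h3 := h (Fin.snoc x t) (fun j => by
          refine Fin.lastCases ?_ (fun j => ?_) j
          · simpa using ht
          · simpa using hx j)
        simpa [Fin.prod_univ_castSucc, Fin.sum_univ_castSucc, mul_assoc] using h3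

end Capacity

section Permanent

variable {n : ℕ}

theorem mixedPerm_ofFn_univ (G : Matrix (Fin n) (Fin n) ℝ) :
    mixedPerm (List.ofFn fun i j => G i j) Finset.univ = permanent G := by
  classical
  rw [mixedPerm_ofFn, permanent, ← Finset.sum_filter]
  refine (Finset.sum_bij (fun (π : Equiv.Perm (Fin n)) _ => (⇑π : Fin n → Fin n)) ?_ ?_ ?_ ?_).symm
  · simp [Equiv.injective]
  · exact fun _ _ _ _ h => DFunLike.coe_injective h
  · intro f hf
    simp only [Finset.mem_filter, Finset.mem_univ, implies_true, and_true, true_and] at hf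
    exact ⟨Equiv.ofBijective f (Finite.injective_iff_bijective.mp hf), Finset.mem_univ _, rfl⟩
  · exact fun _ _ => rfl

theorem permanent_nonneg {G : Matrix (Fin n) (Fin n) ℝ} (h0 : ∀ i j, 0 ≤ G i j) :
    0 ≤ permanent G :=
  Finset.sum_nonneg fun _ _ => Finset.prod_nonneg fun _ _ => h0 _ _

theorem permanent_le_one {G : Matrix (Fin n) (Fin n) ℝ} (h0 : ∀ i j, 0 ≤ G i j)
    (hrow : ∀ i, ∑ j, G i j = 1) : permanent G ≤ 1 := by
  classical
  calc permanent G = ∑ f ∈ Finset.univ.map ⟨fun π : Equiv.Perm (Fin n) => (⇑π : Fin n → Fin n),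
        DFunLike.coe_injective⟩, ∏ i, G i (f i) := by rw [Finset.sum_map]; rfl
    _ ≤ ∑ f : Fin n → Fin n, ∏ i, G i (f i) :=
      Finset.sum_le_sum_of_subset_of_nonneg (Finset.subset_univ _)
        fun _ _ _ => Finset.prod_nonneg fun _ _ => h0 _ _
    _ = ∏ i, ∑ j, G i j := (Fintype.prod_sum _).symm
    _ = 1 := by simp [hrow]

theorem prod_le_prod_sum_mul {G : Matrix (Fin n) (Fin n) ℝ} (h0 : ∀ i j, 0 ≤ G i j)
    (hrow : ∀ i, ∑ j, G i j = 1) (hcol : ∀ j, ∑ i, G i j = 1) {x : Fin n → ℝ}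
    (hx : ∀ i, 0 < x i) : ∏ i, x i ≤ ∏ j, ∑ i, x i * G i j := by
  calc ∏ i, x i = ∏ i, x i ^ ∑ j, G i j := by simp [hrow]
    _ = ∏ i, ∏ j, x i ^ G i j :=
      Finset.prod_congr rfl fun i _ => Real.rpow_sum_of_pos (hx i) _ _
    _ = ∏ j, ∏ i, x i ^ G i j := Finset.prod_comm
    _ ≤ ∏ j, ∑ i, x i * G i j := by
      refine Finset.prod_le_prod
        (fun j _ => Finset.prod_nonneg fun i _ => Real.rpow_nonneg (hx i).le _) fun j _ => ?_
      refine (Real.geom_mean_le_arith_mean_weighted _ (fun i => G i j) x (fun i _ => h0 i j)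
        (hcol j) fun i _ => (hx i).le).trans (le_of_eq ?_)
      exact Finset.sum_congr rfl fun i _ => mul_comm _ _

/-- The van der Waerden bound for positive doubly stochastic matrices. -/
theorem factorial_div_pow_le_permanent_of_pos (hn : n ≠ 0) {G : Matrix (Fin n) (Fin n) ℝ}
    (h0 : ∀ i j, 0 < G i j) (hrow : ∀ i, ∑ j, G i j = 1) (hcol : ∀ j, ∑ i, G i j = 1) :
    (n.factorial : ℝ) / n ^ n ≤ permanent G := by
  obtain ⟨k, rfl⟩ := Nat.exists_eq_succ_of_ne_zero hn
  have h := capacity_le_mixedPerm (κ := ((k + 1).factorial : ℝ)) (fun i j => G i j) h0 (L := [])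
    (by simp) (S := Finset.univ) (by simp) fun x hx => by
      have h1 := mixedPerm_replicate (∑ j, x j • G j) Finset.univ
      rw [Finset.card_univ, Fintype.card_fin] at h1
      rw [List.append_nil, h1]
      refine mul_le_mul_of_nonneg_left ?_ (by positivity)
      simpa using prod_le_prod_sum_mul (fun i j => (h0 i j).le) hrow hcol hx
  rw [List.append_nil, mixedPerm_ofFn_univ] at h
  exact_mod_cast h

/-- The van der Waerden bound for the permanent of a doubly stochastic matrix. -/
theorem factorial_div_pow_le_permanent (hn : n ≠ 0) {G : Matrix (Fin n) (Fin n) ℝ}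
    (h0 : ∀ i j, 0 ≤ G i j) (hrow : ∀ i, ∑ j, G i j = 1) (hcol : ∀ j, ∑ i, G i j = 1) :
    (n.factorial : ℝ) / n ^ n ≤ permanent G := by
  have hn0 : (0 : ℝ) < n := by exact_mod_cast Nat.pos_of_ne_zero hn
  let H : ℝ → Matrix (Fin n) (Fin n) ℝ := fun ε => Matrix.of fun i j => (1 - ε) * G i j + ε / n
  have hH : Continuous fun ε => permanent (H ε) := by
    unfold permanent
    simp only [H, Matrix.of_apply]
    fun_prop
  have hlim : Tendsto (fun ε => permanent (H ε)) (nhdsWithin 0 (Set.Ioi 0))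
      (nhds (permanent G)) := by
    have : H 0 = G := by ext i j; simp [H]
    have h := hH.tendsto 0
    rw [this] at h
    exact h.mono_left nhdsWithin_le_nhds
  refine ge_of_tendsto hlim ?_
  filter_upwards [Ioo_mem_nhdsGT (zero_lt_one (α := ℝ))] with ε hε
  refine factorial_div_pow_le_permanent_of_pos hn (fun i j => ?_) (fun i => ?_) (fun j => ?_)
  · have h1 := mul_nonneg (sub_nonneg.mpr hε.2.le) (h0 i j)
    have h2 := div_pos hε.1 hn0
    simp only [H, Matrix.of_apply]
    linarith
  · simp only [H, Matrix.of_apply, Finset.sum_add_distrib, ← Finset.mul_sum, hrow]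
    simp [field]
  · simp only [H, Matrix.of_apply, Finset.sum_add_distrib, ← Finset.mul_sum, hcol]
    simp [field]

end Permanent

section ScalingMean

variable {n : ℕ}

theorem le_sum_mul_mul_of_doublyStochastic (hn : n ≠ 0) {G : Matrix (Fin n) (Fin n) ℝ}
    (h0 : ∀ i j, 0 ≤ G i j) (hrow : ∀ i, ∑ j, G i j = 1) (hcol : ∀ j, ∑ i, G i j = 1)
    {x y : Fin n → ℝ} (hx : ∀ i, 0 < x i) (hy : ∀ i, 0 < y i) :
    n * ((∏ i, x i) ^ (n : ℝ)⁻¹ * (∏ i, y i) ^ (n : ℝ)⁻¹) ≤ ∑ i, ∑ j, x i * G i j * y j := by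
  have hn0 : (0 : ℝ) < n := by exact_mod_cast Nat.pos_of_ne_zero hn
  have h := Real.geom_mean_le_arith_mean_weighted Finset.univ
    (fun p : Fin n × Fin n => G p.1 p.2 / n) (fun p => x p.1 * y p.2)
    (fun p _ => div_nonneg (h0 _ _) hn0.le)
    (by simp only [Fintype.sum_prod_type, ← Finset.sum_div, hrow]; simp [hn])
    (fun p _ => (mul_pos (hx _) (hy _)).le)
  have e1 : ∏ p : Fin n × Fin n, (x p.1 * y p.2) ^ (G p.1 p.2 / n) =
      (∏ i, x i) ^ (n : ℝ)⁻¹ * (∏ i, y i) ^ (n : ℝ)⁻¹ := by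
    simp only [Real.mul_rpow (hx _).le (hy _).le, Finset.prod_mul_distrib]
    congr 1
    · rw [Fintype.prod_prod_type, ← Real.finsetProd_rpow _ _ fun i _ => (hx i).le]
      refine Finset.prod_congr rfl fun i _ => ?_
      rw [← Real.rpow_sum_of_pos (hx i), ← Finset.sum_div, hrow, one_div]
    · rw [Fintype.prod_prod_type_right, ← Real.finsetProd_rpow _ _ fun i _ => (hy i).le]
      refine Finset.prod_congr rfl fun j _ => ?_
      rw [← Real.rpow_sum_of_pos (hy j), ← Finset.sum_div, hcol, one_div]
  have e2 : ∑ p : Fin n × Fin n, G p.1 p.2 / n * (x p.1 * y p.2) =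
      (∑ i, ∑ j, x i * G i j * y j) / n := by
    simp only [Fintype.sum_prod_type, Finset.sum_div]
    exact Finset.sum_congr rfl fun i _ => Finset.sum_congr rfl fun j _ => by ring
  rw [e1, e2, le_div_iff₀ hn0] at h
  linarith

theorem scalingMeanMat_of_sinkhorn (hn : n ≠ 0) {M G : Matrix (Fin n) (Fin n) ℝ} {d e : Fin n → ℝ}
    (hd : ∀ i, 0 < d i) (he : ∀ i, 0 < e i) (h0 : ∀ i j, 0 ≤ G i j)
    (hrow : ∀ i, ∑ j, G i j = 1) (hcol : ∀ j, ∑ i, G i j = 1)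
    (hM : ∀ i j, M i j = d i * G i j * e j) :
    scalingMeanMat M = (∏ i, d i) ^ (n : ℝ)⁻¹ * (∏ i, e i) ^ (n : ℝ)⁻¹ / n := by
  have hn0 : (0 : ℝ) < n := by exact_mod_cast Nat.pos_of_ne_zero hn
  have hprod : ∀ f : Fin n → ℝ, (∀ i, 0 < f i) → 0 < ∏ i, f i :=
    fun f hf => Finset.prod_pos fun i _ => hf i
  have hgm : ∀ f : Fin n → ℝ, (∀ i, 0 < f i) → 0 < (∏ i, f i) ^ (n : ℝ)⁻¹ :=
    fun f hf => Real.rpow_pos_of_pos (hprod f hf) _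
  have hleast : IsLeast { r : ℝ | ∃ x y : Fin n → ℝ,
      (∀ i, 0 < x i) ∧ (∀ i, 0 < y i) ∧
      r = (∑ i, ∑ j, x i * M i j * y j) /
        ((∏ i, x i) ^ ((n : ℝ)⁻¹) * (∏ i, y i) ^ ((n : ℝ)⁻¹)) }
      (n * ((∏ i, d i) ^ (n : ℝ)⁻¹ * (∏ i, e i) ^ (n : ℝ)⁻¹)) := by
    constructor
    · refine ⟨fun i => (d i)⁻¹, fun i => (e i)⁻¹, fun i => inv_pos.mpr (hd i),
        fun i => inv_pos.mpr (he i), ?_⟩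
      have : ∀ i j, (d i)⁻¹ * M i j * (e j)⁻¹ = G i j := fun i j => by
        have := (hd i).ne'
        have := (he j).ne'
        rw [hM]
        field_simp
      simp only [this, hrow, Finset.prod_inv_distrib, Real.inv_rpow (hprod d hd).le,
        Real.inv_rpow (hprod e he).le]
      simp [field]
    · rintro _ ⟨x, y, hx, hy, rfl⟩
      rw [le_div_iff₀ (mul_pos (hgm x hx) (hgm y hy))]
      have h := le_sum_mul_mul_of_doublyStochastic hn h0 hrow hcol
        (fun i => mul_pos (hx i) (hd i)) (fun i => mul_pos (he i) (hy i))
      simp only [Finset.prod_mul_distrib] at h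
      rw [Real.mul_rpow (hprod x hx).le (hprod d hd).le,
        Real.mul_rpow (hprod e he).le (hprod y hy).le] at h
      calc _ = _ := by ring
        _ ≤ _ := h
        _ = _ := Finset.sum_congr rfl fun i _ => Finset.sum_congr rfl fun j _ => by
          rw [hM]; ring
  rw [scalingMeanMat, hleast.csInf_eq]
  field_simp

theorem permMean_of_sinkhorn {M G : Matrix (Fin n) (Fin n) ℝ} {d e : Fin n → ℝ}
    (hd : ∀ i, 0 < d i) (he : ∀ i, 0 < e i) (h0 : ∀ i j, 0 ≤ G i j)
    (hM : ∀ i j, M i j = d i * G i j * e j) :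
    permMean M = (∏ i, d i) ^ (n : ℝ)⁻¹ * (∏ i, e i) ^ (n : ℝ)⁻¹ * permMean G := by
  have hprod : ∀ f : Fin n → ℝ, (∀ i, 0 < f i) → 0 ≤ ∏ i, f i :=
    fun f hf => Finset.prod_nonneg fun i _ => (hf i).le
  have : permanent M = (∏ i, d i) * (∏ i, e i) * permanent G := by
    simp only [permanent, hM, Finset.prod_mul_distrib, Finset.mul_sum]
    refine Finset.sum_congr rfl fun π _ => ?_
    rw [Equiv.prod_comp π e]
    ring
  rw [permMean, permMean, this, mul_div_assoc,
    Real.mul_rpow (mul_nonneg (hprod d hd) (hprod e he))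
      (div_nonneg (permanent_nonneg h0) (by positivity)),
    Real.mul_rpow (hprod d hd) (hprod e he)]

theorem permMean_mem_Icc_of_doublyStochastic (hn : n ≠ 0) {G : Matrix (Fin n) (Fin n) ℝ}
    (h0 : ∀ i j, 0 ≤ G i j) (hrow : ∀ i, ∑ j, G i j = 1) (hcol : ∀ j, ∑ i, G i j = 1) :
    permMean G ∈ Set.Icc (1 / (n : ℝ)) (Real.exp 1 / n) := by
  have hn0 : (0 : ℝ) < n := by exact_mod_cast Nat.pos_of_ne_zero hn
  have hf : (0 : ℝ) < n.factorial := by exact_mod_cast n.factorial_pos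
  constructor
  · rw [← Real.pow_rpow_inv_natCast (x := 1 / (n : ℝ)) (by positivity) hn, permMean]
    refine Real.rpow_le_rpow (by positivity) ?_ (by positivity)
    rw [le_div_iff₀ hf, one_div_pow, one_div_mul_eq_div]
    exact factorial_div_pow_le_permanent hn h0 hrow hcol
  · rw [← Real.pow_rpow_inv_natCast (x := Real.exp 1 / (n : ℝ)) (by positivity) hn, permMean]
    refine Real.rpow_le_rpow (div_nonneg (permanent_nonneg h0) hf.le) ?_ (by positivity)
    refine (div_le_div_of_nonneg_right (permanent_le_one h0 hrow) hf.le).trans ?_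
    have h := Real.pow_div_factorial_le_exp (n : ℝ) hn0.le n
    rw [div_pow, ← Real.exp_nat_mul, mul_one, le_div_iff₀ (by positivity)]
    rwa [one_div_mul_eq_div]

end ScalingMean

/-- for matrices admitting a Sinkhorn decomposition, the ratio of the
permanental mean to the scaling mean lies asymptotically between `1` and `e`. -/
theorem permMean_div_scalingMean_between_one_and_e
    (M : (n : ℕ) → Matrix (Fin n) (Fin n) ℝ)
    (hnn : ∀ n i j, 0 ≤ M n i j)
    (hSink : ∀ n : ℕ, ∃ d e : Fin n → ℝ, (∀ i, 0 < d i) ∧ (∀ i, 0 < e i) ∧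
      ∃ G : Matrix (Fin n) (Fin n) ℝ, (∀ i j, 0 ≤ G i j) ∧
        (∀ i, ∑ j, G i j = 1) ∧ (∀ j, ∑ i, G i j = 1) ∧
        ∀ i j, M n i j = d i * G i j * e j) :
    1 ≤ liminf (fun n : ℕ => permMean (M n) / scalingMeanMat (M n)) atTop ∧
    limsup (fun n : ℕ => permMean (M n) / scalingMeanMat (M n)) atTop ≤ Real.exp 1 := by
  have key : ∀ᶠ n : ℕ in atTop, permMean (M n) / scalingMeanMat (M n) ∈ Set.Icc 1 (Real.exp 1) := by
    filter_upwards [eventually_ne_atTop 0] with n hn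
    obtain ⟨d, e, hd, he, G, h0, hrow, hcol, hM⟩ := hSink n
    have hn0 : (0 : ℝ) < n := by exact_mod_cast Nat.pos_of_ne_zero hn
    have hgm : ∀ f : Fin n → ℝ, (∀ i, 0 < f i) → 0 < (∏ i, f i) ^ (n : ℝ)⁻¹ :=
      fun f hf => Real.rpow_pos_of_pos (Finset.prod_pos fun i _ => hf i) _
    have hd' := hgm d hd
    have he' := hgm e he
    have hratio : permMean (M n) / scalingMeanMat (M n) = n * permMean G := by
      rw [permMean_of_sinkhorn hd he h0 hM, scalingMeanMat_of_sinkhorn hn hd he h0 hrow hcol hM]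
      rw [div_div_eq_mul_div, mul_assoc, mul_div_cancel_left₀ _ (mul_pos hd' he').ne', mul_comm]
    obtain ⟨h1, h2⟩ := permMean_mem_Icc_of_doublyStochastic hn h0 hrow hcol
    rw [div_le_iff₀ hn0] at h1
    rw [le_div_iff₀ hn0] at h2
    rw [hratio, mul_comm]
    exact ⟨h1, h2⟩
  have hlower : ∀ᶠ n : ℕ in atTop, 1 ≤ permMean (M n) / scalingMeanMat (M n) :=
    key.mono fun _ h => h.1
  have hupper : ∀ᶠ n : ℕ in atTop, permMean (M n) / scalingMeanMat (M n) ≤ Real.exp 1 :=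
    key.mono fun _ h => h.2
  exact ⟨le_liminf_of_le (isBoundedUnder_of_eventually_le hupper).isCoboundedUnder_ge hlower,
    limsup_le_of_le (isBoundedUnder_of_eventually_ge hlower).isCoboundedUnder_le hupper⟩
end
end

section
/- Let M_n = (m_{ij}) be an n×n matrix with nonnegative entries, not identically zero. Then M_n admits a Sinkhorn decomposition M_n = D_n G_n E_n, where D_n and E_n are diagonal matrices with strictly positive diagonal entries and G_n ∈ Ω_n is doubly stochastic, if and only if for each entry m_{ij} > 0 there exists a permutation π ∈ S_n with π(i) = j such that m_{1π(1)}, …, m_{nπ(n)} are all positive. Moreover, the doubly stochastic matrix G_n in such a decomposition is unique. -/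
noncomputable section

/-- `G` is a doubly stochastic `n × n` matrix. -/
def IsDoublyStochastic {n : ℕ} (G : Matrix (Fin n) (Fin n) ℝ) : Prop :=
  (∀ i j, 0 ≤ G i j) ∧ (∀ i, ∑ j, G i j = 1) ∧ (∀ j, ∑ i, G i j = 1)

/-- `M = D G E` with `D = diag d`, `E = diag e`, `d, e > 0`, `G` doubly stochastic. -/
def IsSinkhornDecomposition {n : ℕ} (M : Matrix (Fin n) (Fin n) ℝ)
    (d e : Fin n → ℝ) (G : Matrix (Fin n) (Fin n) ℝ) : Prop :=
  (∀ i, 0 < d i) ∧ (∀ i, 0 < e i) ∧ IsDoublyStochastic G ∧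
    ∀ i j, M i j = d i * G i j * e j

/-- A lower bound showing that `t ↦ m * exp t - g * t` is coercive. -/
lemma mul_abs_sub_le_mul_exp_sub {m g : ℝ} (hm : 0 < m) (hg : 0 < g) (t : ℝ) :
    g * |t| - |2 * g * (1 - Real.log (2 * g / m))| ≤ m * Real.exp t - g * t := by
  rcases le_total t 0 with ht | ht
  · rw [abs_of_nonpos ht]
    have := abs_nonneg (2 * g * (1 - Real.log (2 * g / m)))
    have := mul_pos hm (Real.exp_pos t)
    linarith
  · rw [abs_of_nonneg ht]
    have hs : 0 < 2 * g / m := by positivity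
    have h1 := Real.add_one_le_exp (t - Real.log (2 * g / m))
    rw [Real.exp_sub, Real.exp_log hs, le_div_iff₀ hs] at h1
    have h2 := mul_le_mul_of_nonneg_left h1 hm.le
    have h3 : m * ((t - Real.log (2 * g / m) + 1) * (2 * g / m)) =
        2 * g * t + 2 * g * (1 - Real.log (2 * g / m)) := by
      field_simp
      ring
    have := neg_abs_le (2 * g * (1 - Real.log (2 * g / m)))
    linarith

lemma tendsto_sum_mul_exp_sub_cocompact {ι : Type*} [Fintype ι] {m g : ι → ℝ}
    (hm : ∀ p, 0 < m p) (hg : ∀ p, 0 < g p) :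
    Filter.Tendsto (fun z : ι → ℝ => ∑ p, (m p * Real.exp (z p) - g p * z p))
      (Filter.cocompact (ι → ℝ)) Filter.atTop := by
  set C : ℝ := ∑ p, |2 * g p * (1 - Real.log (2 * g p / m p))|
  set K : ℝ := 1 + ∑ p, (g p)⁻¹
  have hinv (p : ι) : 0 < (g p)⁻¹ := inv_pos.2 (hg p)
  have hK : 0 < K := add_pos_of_pos_of_nonneg one_pos (Finset.sum_nonneg fun p _ => (hinv p).le)
  have hterm (z : ι → ℝ) (q : ι) : 0 ≤ g q * |z q| := mul_nonneg (hg q).le (abs_nonneg _)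
  have hnorm (z : ι → ℝ) : ‖z‖ ≤ K * ∑ p, g p * |z p| := by
    have hS : 0 ≤ ∑ p, g p * |z p| := Finset.sum_nonneg fun q _ => hterm z q
    refine (pi_norm_le_iff_of_nonneg (by positivity)).2 fun q => ?_
    have h1 : g q * |z q| ≤ ∑ p, g p * |z p| :=
      Finset.single_le_sum (f := fun p => g p * |z p|) (fun q _ => hterm z q) (Finset.mem_univ q)
    have h2 : (g q)⁻¹ ≤ ∑ p, (g p)⁻¹ :=
      Finset.single_le_sum (f := fun p => (g p)⁻¹) (fun q _ => (hinv q).le) (Finset.mem_univ q)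
    calc ‖z q‖ = (g q)⁻¹ * (g q * |z q|) := by
          rw [Real.norm_eq_abs, inv_mul_cancel_left₀ (hg q).ne']
      _ ≤ K * ∑ p, g p * |z p| :=
          mul_le_mul (h2.trans (le_add_of_nonneg_left zero_le_one)) h1 (hterm z q) hK.le
  have hlow (z : ι → ℝ) : K⁻¹ * ‖z‖ - C ≤ ∑ p, (m p * Real.exp (z p) - g p * z p) := by
    have h1 : ∑ p, g p * |z p| - C ≤ ∑ p, (m p * Real.exp (z p) - g p * z p) := by
      rw [← Finset.sum_sub_distrib]
      exact Finset.sum_le_sum fun p _ => mul_abs_sub_le_mul_exp_sub (hm p) (hg p) (z p)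
    have h2 : K⁻¹ * ‖z‖ ≤ ∑ p, g p * |z p| := (inv_mul_le_iff₀ hK).2 (hnorm z)
    linarith
  refine Filter.tendsto_atTop_mono hlow ?_
  exact Filter.tendsto_atTop_add_const_right _ _
    ((tendsto_norm_cocompact_atTop (E := ι → ℝ)).const_mul_atTop (inv_pos.2 hK))

/-- For positive weights `m` and `g`, every subspace `V` contains a point `z` such that
`m * exp z - g` is orthogonal to `V`. -/
lemma exists_mem_sum_mul_exp_eq {ι : Type*} [Fintype ι] {m g : ι → ℝ}
    (hm : ∀ p, 0 < m p) (hg : ∀ p, 0 < g p) (V : Submodule ℝ (ι → ℝ)) :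
    ∃ z ∈ V, ∀ v ∈ V, ∑ p, m p * Real.exp (z p) * v p = ∑ p, g p * v p := by
  set f : (ι → ℝ) → ℝ := fun z => ∑ p, (m p * Real.exp (z p) - g p * z p)
  have hf : Continuous f := by fun_prop
  obtain ⟨z, hzV, hz⟩ := hf.continuousOn.exists_isMinOn' V.closed_of_finiteDimensional V.zero_mem
    (Filter.Eventually.filter_mono inf_le_left
      ((tendsto_sum_mul_exp_sub_cocompact hm hg).eventually_ge_atTop (f 0)))
  refine ⟨z, hzV, fun v hv => ?_⟩
  have hmin : IsLocalMin (fun s : ℝ => f (z + s • v)) 0 := by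
    refine Filter.Eventually.of_forall fun s => ?_
    simpa using hz (V.add_mem hzV (V.smul_mem s hv))
  have hder : HasDerivAt (fun s : ℝ => f (z + s • v))
      (∑ p, (m p * (Real.exp (z p) * v p) - g p * v p)) 0 := by
    refine HasDerivAt.fun_sum fun p _ => ?_
    have h1 : HasDerivAt (fun s : ℝ => (z + s • v) p) (v p) 0 := by
      simpa using ((hasDerivAt_id (0 : ℝ)).mul_const (v p)).const_add (z p)
    simpa using (h1.exp.const_mul (m p)).fun_sub (h1.const_mul (g p))
  have h0 := hmin.hasDerivAt_eq_zero hder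
  rw [Finset.sum_sub_distrib, sub_eq_zero] at h0
  simpa only [mul_assoc] using h0

/-- A nonnegative matrix can be scaled to be doubly stochastic as soon as some doubly stochastic
matrix has the same support. -/
lemma exists_isSinkhornDecomposition_of_support {n : ℕ} {M H : Matrix (Fin n) (Fin n) ℝ}
    (hM : ∀ i j, 0 ≤ M i j) (hH : IsDoublyStochastic H) (hpos : ∀ i j, 0 < M i j ↔ 0 < H i j) :
    ∃ (d e : Fin n → ℝ) (G : Matrix (Fin n) (Fin n) ℝ), IsSinkhornDecomposition M d e G := by
  classical
  obtain ⟨hH0, hHrow, hHcol⟩ := hH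
  let S : Type := {p : Fin n × Fin n // 0 < M p.1 p.2}
  let A : ((Fin n → ℝ) × (Fin n → ℝ)) →ₗ[ℝ] (S → ℝ) :=
    { toFun := fun u p => u.1 p.1.1 + u.2 p.1.2
      map_add' := fun u v => by ext p; simp; ring
      map_smul' := fun c u => by ext p; simp; ring }
  obtain ⟨_, ⟨⟨x, y⟩, rfl⟩, hz⟩ := exists_mem_sum_mul_exp_eq
    (m := fun p : S => M p.1.1 p.1.2) (g := fun p : S => H p.1.1 p.1.2)
    (fun p => p.2) (fun p => (hpos _ _).1 p.2) (LinearMap.range A)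
  have hsum (F : Fin n → Fin n → ℝ) (hF : ∀ i j, ¬ 0 < M i j → F i j = 0) :
      ∑ p : S, F p.1.1 p.1.2 = ∑ i, ∑ j, F i j := by
    rw [← Fintype.sum_prod_type' F]
    rw [← Finset.sum_filter_of_ne (p := fun p : Fin n × Fin n => 0 < M p.1 p.2)
      fun p _ hp => not_imp_comm.1 (hF p.1 p.2) hp]
    exact (Finset.sum_subtype _ (by simp) fun p : Fin n × Fin n => F p.1 p.2).symm
  have key (a b : Fin n → ℝ) :
      ∑ i, ∑ j, M i j * Real.exp (x i + y j) * (a i + b j) = ∑ i, ∑ j, H i j * (a i + b j) := by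
    rw [← hsum (fun i j => M i j * Real.exp (x i + y j) * (a i + b j)),
      ← hsum (fun i j => H i j * (a i + b j))]
    · exact hz _ ⟨(a, b), rfl⟩
    · intro i j h
      rw [hpos] at h
      simp [le_antisymm (not_lt.1 h) (hH0 i j)]
    · intro i j h
      simp [le_antisymm (not_lt.1 h) (hM i j)]
  refine ⟨fun i => Real.exp (-x i), fun j => Real.exp (-y j),
    fun i j => M i j * Real.exp (x i + y j), fun i => Real.exp_pos _, fun j => Real.exp_pos _,
    ⟨fun i j => mul_nonneg (hM i j) (Real.exp_pos _).le, fun i => ?_, fun j => ?_⟩, fun i j => ?_⟩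
  · have h := key (Pi.single i 1) 0
    simpa [Pi.single_apply, ← Finset.sum_mul, hHrow] using h
  · have h := key 0 (Pi.single j 1)
    rw [Finset.sum_comm, Finset.sum_comm (f := fun i k => H i k * _)] at h
    simpa [Pi.single_apply, ← Finset.sum_mul, hHcol] using h
  · simp only [Real.exp_add, Real.exp_neg]
    field_simp

/-- If every positive entry of a nonzero matrix lies on a positive permutation, then averaging
the positive permutations gives a doubly stochastic matrix with the same positive entries. -/
lemma exists_isDoublyStochastic_pos_iff {n : ℕ} {M : Matrix (Fin n) (Fin n) ℝ}
    (hne : ∃ i j, 0 < M i j)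
    (h : ∀ i j, 0 < M i j → ∃ π : Equiv.Perm (Fin n), π i = j ∧ ∀ k, 0 < M k (π k)) :
    ∃ H, IsDoublyStochastic H ∧ ∀ i j, 0 < M i j ↔ 0 < H i j := by
  classical
  set P : Finset (Equiv.Perm (Fin n)) := {π | ∀ k, 0 < M k (π k)} with hP
  obtain ⟨i₀, j₀, h₀⟩ := hne
  obtain ⟨π₀, -, hπ₀⟩ := h i₀ j₀ h₀
  have hcard : (0 : ℝ) < P.card := by
    exact_mod_cast Finset.card_pos.2 ⟨π₀, by simpa [hP] using hπ₀⟩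
  refine ⟨fun i j => (P.card : ℝ)⁻¹ * ∑ π ∈ P, if π i = j then 1 else 0,
    ⟨fun i j => ?_, fun i => ?_, fun j => ?_⟩, fun i j => ?_⟩
  · exact mul_nonneg (inv_pos.2 hcard).le (Finset.sum_nonneg fun π _ => by split <;> simp)
  · rw [← Finset.mul_sum, Finset.sum_comm]
    simp [hcard.ne']
  · rw [← Finset.mul_sum, Finset.sum_comm]
    simp [← Equiv.eq_symm_apply, hcard.ne']
  · rw [mul_pos_iff_of_pos_left (inv_pos.2 hcard), Finset.sum_boole, Nat.cast_pos,
      Finset.card_pos]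
    constructor
    · intro hij
      obtain ⟨π, hπ, hpos⟩ := h i j hij
      exact ⟨π, by simp [hP, hπ, hpos]⟩
    · rintro ⟨π, hπ⟩
      simp only [hP, Finset.mem_filter, Finset.mem_univ, true_and] at hπ
      exact hπ.2 ▸ hπ.1 i

/-- Every positive entry of a doubly stochastic matrix lies on a positive permutation. -/
lemma IsDoublyStochastic.exists_perm_pos {n : ℕ} {G : Matrix (Fin n) (Fin n) ℝ}
    (hG : IsDoublyStochastic G) {i j : Fin n} (hij : 0 < G i j) :
    ∃ π : Equiv.Perm (Fin n), π i = j ∧ ∀ k, 0 < G k (π k) := by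
  obtain ⟨w, hw, -, rfl⟩ :=
    exists_eq_sum_perm_of_mem_doublyStochastic (mem_doublyStochastic_iff_sum.2 hG)
  have happly (k l : Fin n) : (∑ σ, w σ • Equiv.Perm.permMatrix ℝ σ) k l =
      ∑ σ : Equiv.Perm (Fin n), if σ k = l then w σ else 0 := by
    simp [Matrix.sum_apply, Equiv.toPEquiv_apply, PEquiv.toMatrix_apply]
  simp only [happly] at hij ⊢
  obtain ⟨π, -, hπ⟩ := Finset.exists_lt_of_sum_lt (f := fun _ => (0 : ℝ)) (by simpa using hij)
  have hπij : π i = j := by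
    by_contra hne
    simp [hne] at hπ
  refine ⟨π, hπij, fun k => ?_⟩
  rw [if_pos hπij] at hπ
  refine Finset.sum_pos' (fun σ _ => ?_) ⟨π, Finset.mem_univ _, by simpa using hπ⟩
  split
  exacts [hw σ, le_rfl]

/-- Two doubly stochastic matrices that are diagonally equivalent with positive diagonals are
equal. -/
lemma IsDoublyStochastic.eq_of_scaling {n : ℕ} {G G' : Matrix (Fin n) (Fin n) ℝ}
    (hG : IsDoublyStochastic G) (hG' : IsDoublyStochastic G') {a b : Fin n → ℝ}
    (ha : ∀ i, 0 < a i) (hb : ∀ j, 0 < b j) (h : ∀ i j, G' i j = a i * G i j * b j) :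
    G = G' := by
  have hterm (i j : Fin n) : (G' i j - G i j) * (Real.log (a i) + Real.log (b j)) =
      G i j * ((a i * b j - 1) * Real.log (a i * b j)) := by
    rw [h, Real.log_mul (ha i).ne' (hb j).ne']
    ring
  have hlog {t : ℝ} (ht : 0 < t) : 0 ≤ (t - 1) * Real.log t := by
    rcases le_total 1 t with h1 | h1
    · exact mul_nonneg (sub_nonneg.2 h1) (Real.log_nonneg h1)
    · exact mul_nonneg_of_nonpos_of_nonpos (sub_nonpos.2 h1) (Real.log_nonpos ht.le h1)
  have hnonneg (i j : Fin n) :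
      0 ≤ (G' i j - G i j) * (Real.log (a i) + Real.log (b j)) := by
    rw [hterm]
    exact mul_nonneg (hG.1 i j) (hlog (mul_pos (ha i) (hb j)))
  have hsum : ∑ i, ∑ j, (G' i j - G i j) * (Real.log (a i) + Real.log (b j)) = 0 := by
    simp only [mul_add, Finset.sum_add_distrib]
    rw [Finset.sum_comm (f := fun i j => (G' i j - G i j) * Real.log (b j))]
    simp [← Finset.sum_mul, hG.2.1, hG.2.2, hG'.2.1, hG'.2.2]
  ext i j
  rw [Finset.sum_eq_zero_iff_of_nonneg fun i _ => Finset.sum_nonneg fun j _ => hnonneg i j] at hsum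
  have hij := (Finset.sum_eq_zero_iff_of_nonneg fun j _ => hnonneg i j).1
    (hsum i (Finset.mem_univ i)) j (Finset.mem_univ j)
  have hab := mul_pos (ha i) (hb j)
  rcases mul_eq_zero.1 hij with h0 | h0
  · exact (sub_eq_zero.1 h0).symm
  · rw [← Real.log_mul (ha i).ne' (hb j).ne'] at h0
    rw [h, mul_right_comm, Real.eq_one_of_pos_of_log_eq_zero hab h0, one_mul]

/-- Sinkhorn decomposition of a nonnegative matrix exists iff every
positive entry lies on a positive permutation; moreover the doubly stochastic factor is
unique. -/
theorem sinkhorn_decomposition_matrix (n : ℕ) (M : Matrix (Fin n) (Fin n) ℝ)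
    (hnn : ∀ i j, 0 ≤ M i j) (hne : ∃ i j, M i j ≠ 0) :
    ((∃ (d e : Fin n → ℝ) (G : Matrix (Fin n) (Fin n) ℝ),
        IsSinkhornDecomposition M d e G) ↔
      (∀ i j, 0 < M i j → ∃ π : Equiv.Perm (Fin n), π i = j ∧ ∀ k, 0 < M k (π k))) ∧
    (∀ (d e : Fin n → ℝ) (G : Matrix (Fin n) (Fin n) ℝ)
        (d' e' : Fin n → ℝ) (G' : Matrix (Fin n) (Fin n) ℝ),
      IsSinkhornDecomposition M d e G → IsSinkhornDecomposition M d' e' G' → G = G') := by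
  refine ⟨⟨?_, fun h => ?_⟩, ?_⟩
  · rintro ⟨d, e, G, hd, he, hG, hM⟩ i j hij
    have hpos (k l : Fin n) : 0 < M k l ↔ 0 < G k l := by
      rw [hM, mul_pos_iff_of_pos_right (he l), mul_pos_iff_of_pos_left (hd k)]
    simp only [hpos] at hij ⊢
    exact hG.exists_perm_pos hij
  · obtain ⟨i, j, hij⟩ := hne
    obtain ⟨H, hH, hpos⟩ :=
      exists_isDoublyStochastic_pos_iff ⟨i, j, (hnn i j).lt_of_ne' hij⟩ h
    exact exists_isSinkhornDecomposition_of_support hnn hH hpos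
  · rintro d e G d' e' G' ⟨hd, he, hG, hM⟩ ⟨hd', he', hG', hM'⟩
    refine hG.eq_of_scaling hG' (a := fun i => d i / d' i) (b := fun j => e j / e' j)
      (fun i => div_pos (hd i) (hd' i)) (fun j => div_pos (he j) (he' j)) fun i j => ?_
    have h := (hM i j).symm.trans (hM' i j)
    have := (hd' i).ne'
    have := (he' j).ne'
    field_simp
    linarith
end
end
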